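/- arXiv:1408.0583 — 5 statements merged into one kernel-verified Lean document; each statement's English description precedes it below -/
import Mathlib

section
/- There exists at most one vector function Q ∈ G(R,Φ,Ψ) satisfying ΔQ + F(∇Q) = 0 in Ω together with the boundary conditions Q = Φ on Γ₁∪Γ₃ and ∂ₙQ = Ψ on Γ₁. -/
noncomputable section

open MeasureTheory Real Set

/-- Partial derivative in coordinate direction `i` of a function on `ℝ³`. -/
def pd (i : Fin 3) (u : (Fin 3 → ℝ) → ℝ) : (Fin 3 → ℝ) → ℝ :=
  fun x => fderiv ℝ u x (Pi.single i 1)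

/-- Laplacian on `ℝ³`. -/
def lap (u : (Fin 3 → ℝ) → ℝ) : (Fin 3 → ℝ) → ℝ :=
  fun x => ∑ i, pd i (pd i u) x

/-- Iterated partial derivative along a list of coordinate directions. -/
def pdList : List (Fin 3) → ((Fin 3 → ℝ) → ℝ) → ((Fin 3 → ℝ) → ℝ)
  | [], u => u
  | i :: l, u => pd i (pdList l u)

/-- The domain `Ω = (-A,A)² × (0,1/2)`. -/
def Omega3 (A : ℝ) : Set (Fin 3 → ℝ) :=
  {x | x 0 ∈ Ioo (-A) A ∧ x 1 ∈ Ioo (-A) A ∧ x 2 ∈ Ioo (0:ℝ) (1/2)}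

/-- `Ω_a = Ω ∩ {x₃ < a}`. -/
def OmegaSub (A a : ℝ) : Set (Fin 3 → ℝ) := Omega3 A ∩ {x | x 2 < a}

/-- `Γ₁ = {x ∈ ∂Ω : x₃ = 0}`. -/
def Gamma1 (A : ℝ) : Set (Fin 3 → ℝ) := {x ∈ frontier (Omega3 A) | x 2 = 0}

/-- `Γ₂ = {x ∈ ∂Ω : x₃ = 1/2}`. -/
def Gamma2 (A : ℝ) : Set (Fin 3 → ℝ) := {x ∈ frontier (Omega3 A) | x 2 = 1/2}

/-- `Γ₃ = ∂Ω \ (Γ₁ ∪ Γ₂)`. -/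
def Gamma3 (A : ℝ) : Set (Fin 3 → ℝ) := frontier (Omega3 A) \ (Gamma1 A ∪ Gamma2 A)

/-- Embedding of `(x₁,x₂)` into the plane `x₃ = z`. -/
def ptz (p : ℝ × ℝ) (z : ℝ) : Fin 3 → ℝ := ![p.1, p.2, z]

/-- The square `(-A,A)²`. -/
def sq2 (A : ℝ) : Set (ℝ × ℝ) := Ioo (-A) A ×ˢ Ioo (-A) A

/-- The Carleman Weight Function `φ_{λ,ν}(x₃) = e^{λ(x₃+ξ)^{-ν}} e^{-λ(a+ξ)^{-ν}}`. -/
def cwf (lam nu xi a : ℝ) (x3 : ℝ) : ℝ :=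
  Real.exp (lam * (x3 + xi) ^ (-nu)) * Real.exp (-lam * (a + xi) ^ (-nu))

/-- Sobolev-type inner product of order `k` over a set `S`
    (the sum over all iterated partial derivatives of order `≤ k`). -/
def sobInnerOn (k : ℕ) (S : Set (Fin 3 → ℝ)) (u v : (Fin 3 → ℝ) → ℝ) : ℝ :=
  ∑ j ∈ Finset.range (k + 1),
    ∫ x in S, ∑ idx : Fin j → Fin 3,
      pdList (List.ofFn idx) u x * pdList (List.ofFn idx) v x

/-- Sobolev inner product of vector functions: the `ℓ²` combination of components. -/
def vSobInnerOn (N : ℕ) (k : ℕ) (S : Set (Fin 3 → ℝ))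
    (Q P : Fin N → (Fin 3 → ℝ) → ℝ) : ℝ :=
  ∑ m, sobInnerOn k S (Q m) (P m)

/-- Sobolev norm of a vector function. -/
def vSobNormOn (N : ℕ) (k : ℕ) (S : Set (Fin 3 → ℝ))
    (Q : Fin N → (Fin 3 → ℝ) → ℝ) : ℝ :=
  Real.sqrt (vSobInnerOn N k S Q Q)

/-- Squared `H¹(Γ₁)` norm of the trace of `u` on `Γ₁` (tangential derivatives). -/
def h1Gamma1Sq (A : ℝ) (u : (Fin 3 → ℝ) → ℝ) : ℝ :=
  ∫ p in sq2 A,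
    ((u (ptz p 0))^2 + (pd 0 u (ptz p 0))^2 + (pd 1 u (ptz p 0))^2)

/-- Squared `L₂(Γ₁)` norm of the normal derivative `∂ₙu = -∂₃u` on `Γ₁`. -/
def l2nGamma1Sq (A : ℝ) (u : (Fin 3 → ℝ) → ℝ) : ℝ :=
  ∫ p in sq2 A, (pd 2 u (ptz p 0))^2

/-- `∫_{Γ₂} (|∇u|² + u²)`. -/
def gamma2Term (A : ℝ) (u : (Fin 3 → ℝ) → ℝ) : ℝ :=
  ∫ p in sq2 A, ((∑ i, (pd i u (ptz p (1/2)))^2) + (u (ptz p (1/2)))^2)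

/-- `F_k(∇Q) = Σ_{m,n} F_{kmn} ∇q_m·∇q_n`. -/
def Fmap {N : ℕ} (Fc : Fin N → Fin N → Fin N → ℝ)
    (Q : Fin N → (Fin 3 → ℝ) → ℝ) (k : Fin N) (x : Fin 3 → ℝ) : ℝ :=
  ∑ m, ∑ n, Fc k m n * ∑ i, pd i (Q m) x * pd i (Q n) x

/-- The directional derivative `F′(∇Q)∇h`, `k`-th component. -/
def FmapDir {N : ℕ} (Fc : Fin N → Fin N → Fin N → ℝ)
    (Q h : Fin N → (Fin 3 → ℝ) → ℝ) (k : Fin N) (x : Fin 3 → ℝ) : ℝ :=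
  ∑ m, ∑ n, Fc k m n *
    ∑ i, (pd i (h m) x * pd i (Q n) x + pd i (Q m) x * pd i (h n) x)

/-- The set `G(R,Φ,Ψ)` (with `H³(Ω)` membership modelled by `C³` smoothness). -/
def GSet (N : ℕ) (A R : ℝ) (Φ Ψ : Fin N → (Fin 3 → ℝ) → ℝ) :
    Set (Fin N → (Fin 3 → ℝ) → ℝ) :=
  {Q | (∀ k, ContDiff ℝ 3 (Q k)) ∧
       vSobNormOn N 3 (Omega3 A) Q < R ∧
       (∀ k, ∀ x ∈ Gamma1 A ∪ Gamma3 A, Q k x = Φ k x) ∧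
       (∀ k, ∀ x ∈ Gamma1 A, -(pd 2 (Q k) x) = Ψ k x)}

/-- The subspace `H₀³(Ω)`: vanishing on `Γ₁ ∪ Γ₃` with vanishing normal derivative on `Γ₁`. -/
def H03 (N : ℕ) (A : ℝ) : Set (Fin N → (Fin 3 → ℝ) → ℝ) :=
  {h | (∀ k, ContDiff ℝ 3 (h k)) ∧
       (∀ k, ∀ x ∈ Gamma1 A ∪ Gamma3 A, h k x = 0) ∧
       (∀ k, ∀ x ∈ Gamma1 A, pd 2 (h k) x = 0)}

/-- The weighted Tikhonov-like functional `J_{λ,α}`. -/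
def Jfun {N : ℕ} (A a xi lam nu0 alpha : ℝ) (Fc : Fin N → Fin N → Fin N → ℝ)
    (Q : Fin N → (Fin 3 → ℝ) → ℝ) : ℝ :=
  (1/2) * (∫ x in Omega3 A,
      (∑ k, (lap (Q k) x + Fmap Fc Q k x)^2) * (cwf lam nu0 xi a (x 2))^2)
  + (alpha/2) * vSobInnerOn N 3 (Omega3 A) Q Q

/-- The Fréchet derivative of `J_{λ,α}` at `Q` applied to `h`. -/
def Jderiv {N : ℕ} (A a xi lam nu0 alpha : ℝ) (Fc : Fin N → Fin N → Fin N → ℝ)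
    (Q h : Fin N → (Fin 3 → ℝ) → ℝ) : ℝ :=
  (∫ x in Omega3 A,
      (∑ k, (lap (Q k) x + Fmap Fc Q k x) * (lap (h k) x + FmapDir Fc Q h k x))
        * (cwf lam nu0 xi a (x 2))^2)
  + alpha * vSobInnerOn N 3 (Omega3 A) Q h

lemma contDiff_pd {n m : WithTop ℕ∞} {u : (Fin 3 → ℝ) → ℝ} (hu : ContDiff ℝ n u)
    (hmn : m + 1 ≤ n) (i : Fin 3) : ContDiff ℝ m (pd i u) :=
  (hu.fderiv_right hmn).clm_apply contDiff_const

lemma hasLineDerivAt_pd {u : (Fin 3 → ℝ) → ℝ} (hu : ContDiff ℝ 1 u) (i : Fin 3)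
    (x : Fin 3 → ℝ) :
    HasLineDerivAt ℝ u (pd i u x) x (Pi.single i 1) :=
  ((hu.differentiable (by norm_num)) x).hasFDerivAt.hasLineDerivAt _

lemma pd_comm {u : (Fin 3 → ℝ) → ℝ} (hu : ContDiff ℝ 2 u) (i j : Fin 3) (x : Fin 3 → ℝ) :
    pd i (pd j u) x = pd j (pd i u) x := by
  have hd : DifferentiableAt ℝ (fderiv ℝ u) x :=
    (hu.fderiv_right (m := 1) (by norm_num)).differentiable (by norm_num) x
  have hs := (hu.contDiffAt (x := x)).isSymmSndFDerivAt (by simp)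
  have key : ∀ i j : Fin 3, pd i (pd j u) x =
      fderiv ℝ (fderiv ℝ u) x (Pi.single i 1) (Pi.single j 1) := by
    intro i j
    change fderiv ℝ (fun y => fderiv ℝ u y (Pi.single j 1)) x (Pi.single i 1) = _
    rw [fderiv_clm_apply hd (by fun_prop)]
    simp
  rw [key, key]
  exact hs _ _

lemma pd_sub {u v : (Fin 3 → ℝ) → ℝ} (hu : ContDiff ℝ 1 u) (hv : ContDiff ℝ 1 v) (i : Fin 3) :
    pd i (fun x => u x - v x) = fun x => pd i u x - pd i v x := by
  funext x
  simp only [pd, fderiv_fun_sub (hu.differentiable (by norm_num) x)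
    (hv.differentiable (by norm_num) x)]
  simp

lemma lap_sub {u v : (Fin 3 → ℝ) → ℝ} (hu : ContDiff ℝ 2 u) (hv : ContDiff ℝ 2 v)
    (x : Fin 3 → ℝ) : lap (fun x => u x - v x) x = lap u x - lap v x := by
  simp only [lap, pd_sub (hu.of_le (by norm_num)) (hv.of_le (by norm_num)),
    pd_sub (contDiff_pd hu (m := 1) (by norm_num) _) (contDiff_pd hv (m := 1) (by norm_num) _),
    Finset.sum_sub_distrib]

lemma continuous_lap {u : (Fin 3 → ℝ) → ℝ} (hu : ContDiff ℝ 2 u) : Continuous (lap u) :=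
  continuous_finsetSum _ fun i _ => (contDiff_pd (contDiff_pd hu (m := 1) (by norm_num) i)
    (m := 0) (by norm_num) i).continuous

/-- A function vanishing on a slice `x j = c` of a box has vanishing tangential derivatives
there. -/
lemma pd_eq_zero_of_slice {u : (Fin 3 → ℝ) → ℝ} (hu : ContDiff ℝ 1 u) {lo hi : Fin 3 → ℝ}
    (hlt : ∀ i, lo i < hi i) {x : Fin 3 → ℝ} (hx : x ∈ Icc lo hi) {i j : Fin 3} (hij : j ≠ i)
    (h0 : ∀ y ∈ Icc lo hi, y j = x j → u y = 0) : pd i u x = 0 := by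
  have h1 : HasDerivAt (fun t => u (Function.update x i t)) (pd i u x) (x i) := by
    have h2 := (hasDerivAt_update x i (x i))
    have h3 : HasFDerivAt u (fderiv ℝ u x) (Function.update x i (x i)) := by
      rw [Function.update_eq_self]
      exact (hu.differentiable (by norm_num) x).hasFDerivAt
    exact h3.comp_hasDerivAt (x i) h2
  have hxi : x i ∈ Icc (lo i) (hi i) := ⟨hx.1 i, hx.2 i⟩
  have h4 : HasDerivWithinAt (fun t => u (Function.update x i t)) 0
      (Icc (lo i) (hi i)) (x i) := by
    have hz : ∀ t ∈ Icc (lo i) (hi i), u (Function.update x i t) = 0 := by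
      intro t ht
      refine h0 _ ⟨fun k => ?_, fun k => ?_⟩ (by simp [hij])
      · rcases eq_or_ne k i with rfl | hk
        · simpa using ht.1
        · simpa [hk] using hx.1 k
      · rcases eq_or_ne k i with rfl | hk
        · simpa using ht.2
        · simpa [hk] using hx.2 k
    exact (hasDerivWithinAt_const (x i) _ (0:ℝ)).congr hz (hz _ hxi)
  exact (uniqueDiffOn_Icc (hlt i) _ hxi).eq_deriv _ h1.hasDerivWithinAt h4

/-- The multiplier of the Carleman argument, written for the unconjugated function. -/
def carlemanMult (lam : ℝ) (u : (Fin 3 → ℝ) → ℝ) (x : Fin 3 → ℝ) : ℝ :=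
  -2 * lam * (x 2 - 1) * (pd 2 u x + lam * (x 2 - 1) * u x) - 2 * lam * u x

/-- The squared Carleman weight `exp (λ (x₃ - 1)²)`. -/
def carlemanWeight (lam : ℝ) (x : Fin 3 → ℝ) : ℝ := Real.exp (lam * (x 2 - 1) ^ 2)

/-- The vertical component of the flux in the Carleman identity, without the weight. -/
def carlemanVert (lam : ℝ) (u : (Fin 3 → ℝ) → ℝ) (x : Fin 3 → ℝ) : ℝ :=
  2 * lam * (x 2 - 1) * (pd 0 u x ^ 2 + pd 1 u x ^ 2)
    - 2 * lam * (x 2 - 1) * (pd 2 u x + lam * (x 2 - 1) * u x) ^ 2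
    - 4 * lam * u x * (pd 2 u x + lam * (x 2 - 1) * u x)
    - (2 * lam ^ 3 * (x 2 - 1) ^ 3 + 2 * lam ^ 2 * (x 2 - 1)) * u x ^ 2

/-- The flux in the Carleman identity. -/
def carlemanFlux (lam : ℝ) (u : (Fin 3 → ℝ) → ℝ) : Fin 3 → (Fin 3 → ℝ) → ℝ :=
  ![fun x => carlemanWeight lam x * (2 * pd 0 u x * carlemanMult lam u x),
    fun x => carlemanWeight lam x * (2 * pd 1 u x * carlemanMult lam u x),
    fun x => carlemanWeight lam x * carlemanVert lam u x]

lemma contDiff_carlemanWeight (lam : ℝ) : ContDiff ℝ 2 (carlemanWeight lam) := by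
  unfold carlemanWeight
  fun_prop

lemma contDiff_carlemanFlux (lam : ℝ) {u : (Fin 3 → ℝ) → ℝ} (hu : ContDiff ℝ 3 u) (i : Fin 3) :
    ContDiff ℝ 2 (carlemanFlux lam u i) := by
  have h := contDiff_carlemanWeight lam
  have hu2 : ContDiff ℝ 2 u := hu.of_le (by norm_num)
  have hp : ∀ i, ContDiff ℝ 2 (pd i u) := contDiff_pd hu (by norm_num)
  have h0 := hp 0
  have h1 := hp 1
  have h2 := hp 2
  fin_cases i <;> simp [carlemanFlux, carlemanMult, carlemanVert] <;> fun_prop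

lemma sum_pd_carlemanFlux (lam : ℝ) {u : (Fin 3 → ℝ) → ℝ} (hu : ContDiff ℝ 3 u)
    (x : Fin 3 → ℝ) :
    ∑ i, pd i (carlemanFlux lam u i) x = carlemanWeight lam x *
      (2 * (lap u x - carlemanMult lam u x) * carlemanMult lam u x
        - 2 * lam * (pd 0 u x ^ 2 + pd 1 u x ^ 2)
        - 6 * lam * (pd 2 u x + lam * (x 2 - 1) * u x) ^ 2
        - (2 * lam ^ 3 * (x 2 - 1) ^ 2 - 2 * lam ^ 2) * u x ^ 2) := by
  have hp : ∀ i, ContDiff ℝ 1 (pd i u) := fun i => contDiff_pd hu (by norm_num) i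
  have hu2 : ContDiff ℝ 2 u := hu.of_le (by norm_num)
  have hF : ∀ i, HasLineDerivAt ℝ (carlemanFlux lam u i) (pd i (carlemanFlux lam u i) x) x
      (Pi.single i 1) :=
    fun i => hasLineDerivAt_pd ((contDiff_carlemanFlux lam hu i).of_le (by norm_num)) i x
  have dU : ∀ i, HasLineDerivAt ℝ u (pd i u x) x (Pi.single i 1) :=
    fun i => hasLineDerivAt_pd (hu.of_le (by norm_num)) i x
  have dP : ∀ i j, HasLineDerivAt ℝ (pd j u) (pd i (pd j u) x) x (Pi.single i 1) :=
    fun i j => hasLineDerivAt_pd (hp j) i x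
  have dz : ∀ i, HasLineDerivAt ℝ (fun y : Fin 3 → ℝ => y 2 - 1)
      ((Pi.single i 1 : Fin 3 → ℝ) 2) x (Pi.single i 1) := by
    intro i
    have : HasDerivAt (fun t : ℝ => x 2 + t * (Pi.single i 1 : Fin 3 → ℝ) 2 - 1)
      ((Pi.single i 1 : Fin 3 → ℝ) 2) 0 := by
      simpa using (((hasDerivAt_id (0:ℝ)).mul_const
        ((Pi.single i 1 : Fin 3 → ℝ) 2)).const_add (x 2)).sub_const 1
    exact this
  unfold HasLineDerivAt at hF dU dP dz
  have dW := fun i => (((dz i).pow 2).const_mul lam).exp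
  have dw := fun i => (dP i 2).add (((dz i).const_mul lam).mul (dU i))
  have dM := fun i => ((((dz i).const_mul (-2 * lam)).mul (dw i))).sub ((dU i).const_mul (2 * lam))
  have dH := fun i (j : Fin 3) => (dW i).mul (((dP i j).const_mul 2).mul (dM i))
  have dV := (dW 2).mul (((((dz 2).const_mul (2 * lam)).mul
      (((dP 2 0).pow 2).add ((dP 2 1).pow 2))).sub
      (((dz 2).const_mul (2 * lam)).mul ((dw 2).pow 2))).sub
      (((dU 2).const_mul (4 * lam)).mul (dw 2)) |>.sub
      (((((dz 2).pow 3).const_mul (2 * lam ^ 3)).add ((dz 2).const_mul (2 * lam ^ 2))).mul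
        ((dU 2).pow 2)))
  have e0 := (hF 0).unique (dH 0 0)
  have e1 := (hF 1).unique (dH 1 1)
  have e2 := (hF 2).unique dV
  rw [Fin.sum_univ_three, e0, e1, e2, lap, Fin.sum_univ_three, pd_comm hu2 0 2, pd_comm hu2 1 2]
  simp [carlemanMult, carlemanWeight]
  ring

lemma carleman_pointwise {lam : ℝ} (hlam : 12 ≤ lam) {u : (Fin 3 → ℝ) → ℝ}
    (hu : ContDiff ℝ 3 u) {x : Fin 3 → ℝ} (hx : x 2 ≤ 1 / 2) :
    carlemanWeight lam x * (lam / 2 * (∑ i, pd i u x ^ 2) + lam ^ 2 * u x ^ 2)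
        + ∑ i, pd i (carlemanFlux lam u i) x
      ≤ carlemanWeight lam x * lap u x ^ 2 := by
  rw [sum_pd_carlemanFlux lam hu, ← mul_add, Fin.sum_univ_three]
  refine mul_le_mul_of_nonneg_left ?_ (Real.exp_pos _).le
  set m := carlemanMult lam u x
  set p := x 2 - 1
  obtain ⟨w, hw⟩ : ∃ w, w = pd 2 u x + lam * p * u x := ⟨_, rfl⟩
  have hz : pd 2 u x = w - lam * p * u x := by rw [hw]; ring
  rw [← hw, hz]
  have hp : 1 / 4 ≤ p ^ 2 := by
    have : p ≤ -1 / 2 := by simp only [p]; linarith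
    nlinarith
  have h1 : 0 ≤ lam * (w + lam * p * u x) ^ 2 := by positivity
  have h2 : 0 ≤ lam ^ 2 * u x ^ 2 * (lam * p ^ 2 - 3) := by
    refine mul_nonneg (by positivity) ?_
    nlinarith
  have h3 : 0 ≤ lam * (pd 0 u x ^ 2 + pd 1 u x ^ 2) := by positivity
  have h4 : 0 ≤ lam * w ^ 2 := by positivity
  nlinarith [sq_nonneg (lap u x - m), sq_nonneg m]

lemma neg_carlemanVert_le {lam : ℝ} (hlam : 0 ≤ lam) (u : (Fin 3 → ℝ) → ℝ) {x : Fin 3 → ℝ}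
    (hx0 : 0 ≤ x 2) (hx : x 2 ≤ 1 / 2) :
    -carlemanVert lam u x ≤
      lam * (4 * u x * pd 2 u x + 2 * (pd 0 u x ^ 2 + pd 1 u x ^ 2)) := by
  unfold carlemanVert
  obtain ⟨q, hq⟩ : ∃ q, x 2 - 1 = -q := ⟨1 - x 2, by ring⟩
  rw [hq]
  have hq0 : 0 ≤ q := by linarith
  have hq1 : 0 ≤ 1 - q := by linarith
  have h1 : 0 ≤ 2 * lam * q * (pd 2 u x + lam * (-q) * u x) ^ 2 := by positivity
  have h2 : 0 ≤ 2 * lam ^ 3 * q ^ 3 * u x ^ 2 := by positivity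
  have h3 : 0 ≤ lam ^ 2 * q * u x ^ 2 := by positivity
  have h4 : 0 ≤ 2 * lam * (1 - q) * (pd 0 u x ^ 2 + pd 1 u x ^ 2) := by positivity
  nlinarith

/-- Carleman estimate on a box for functions with zero lateral data and zero Cauchy data on the
bottom. -/
lemma carleman_estimate {u : (Fin 3 → ℝ) → ℝ} (hu : ContDiff ℝ 3 u) {lo hi : Fin 3 → ℝ}
    (hlt : ∀ i, lo i < hi i) (hlo : 0 ≤ lo 2) (hhi : hi 2 ≤ 1 / 2)
    (hlow : ∀ x ∈ Icc lo hi, ∀ i, x i = lo i → u x = 0)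
    (hupp : ∀ x ∈ Icc lo hi, ∀ i, i ≠ 2 → x i = hi i → u x = 0)
    (hbot : ∀ x ∈ Icc lo hi, x 2 = lo 2 → pd 2 u x = 0) :
    ∃ C, ∀ lam, 12 ≤ lam →
      ∫ x in Icc lo hi, carlemanWeight lam x *
          (lam / 2 * (∑ i, pd i u x ^ 2) + lam ^ 2 * u x ^ 2)
        ≤ (∫ x in Icc lo hi, carlemanWeight lam x * lap u x ^ 2)
          + lam * Real.exp (lam * (hi 2 - 1) ^ 2) * C := by
  have hu1 : ContDiff ℝ 1 u := hu.of_le (by norm_num)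
  have hle : lo ≤ hi := fun i => (hlt i).le
  have cU : Continuous u := hu.continuous
  have cP : ∀ i, Continuous (pd i u) := fun i => (contDiff_pd hu (m := 2) (by norm_num) i).continuous
  have cL : Continuous (lap u) := continuous_lap (hu.of_le (by norm_num))
  let B : (Fin 3 → ℝ) → ℝ := fun x =>
    4 * u x * pd 2 u x + 2 * (pd 0 u x ^ 2 + pd 1 u x ^ 2)
  have cB : Continuous B := by
    have h0 := cP 0
    have h1 := cP 1
    have h2 := cP 2
    fun_prop
  let face : Set (Fin 2 → ℝ) := Icc (lo ∘ (2 : Fin 3).succAbove) (hi ∘ (2 : Fin 3).succAbove)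
  have hmem : ∀ (i : Fin 3) (c : ℝ), c ∈ Icc (lo i) (hi i) →
      ∀ y ∈ Icc (lo ∘ i.succAbove) (hi ∘ i.succAbove), i.insertNth c y ∈ Icc lo hi := by
    intro i c hc y hy
    refine ⟨?_, ?_⟩
    · rw [Fin.le_insertNth_iff]
      exact ⟨hc.1, hy.1⟩
    · rw [Fin.insertNth_le_iff]
      exact ⟨hc.2, hy.2⟩
  refine ⟨∫ y in face, B ((2 : Fin 3).insertNth (hi 2) y), fun lam hlam => ?_⟩
  have cW : Continuous (carlemanWeight lam) := (contDiff_carlemanWeight lam).continuous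
  have cF : ∀ i, Continuous (carlemanFlux lam u i) :=
    fun i => (contDiff_carlemanFlux lam hu i).continuous
  have cD : Continuous (fun x => ∑ i, pd i (carlemanFlux lam u i) x) :=
    continuous_finsetSum _ fun i _ =>
      (contDiff_pd (contDiff_carlemanFlux lam hu i) (m := 1) (by norm_num) i).continuous
  have hInt : ∀ {g : (Fin 3 → ℝ) → ℝ}, Continuous g → IntegrableOn g (Icc lo hi) :=
    fun hg => hg.continuousOn.integrableOn_Icc
  have hdiv := integral_divergence_of_hasFDerivAt_off_countable' lo hi hle (carlemanFlux lam u)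
    (fun i => fderiv ℝ (carlemanFlux lam u i)) ∅ countable_empty (fun i => (cF i).continuousOn)
    (fun x _ i => ((contDiff_carlemanFlux lam hu i).differentiable (by norm_num) x).hasFDerivAt)
    (hInt cD)
  have hside : ∀ j : Fin 3, j ≠ 2 → ∀ x ∈ Icc lo hi, (x j = lo j ∨ x j = hi j) →
      carlemanFlux lam u j x = 0 := by
    intro j hj x hx hxj
    have hz : ∀ y ∈ Icc lo hi, y j = x j → u y = 0 := by
      intro y hy hyj
      rcases hxj with h | h
      · exact hlow y hy j (hyj.trans h)
      · exact hupp y hy j hj (hyj.trans h)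
    have h1 : u x = 0 := hz x hx rfl
    have h2 : pd 2 u x = 0 := pd_eq_zero_of_slice hu1 hlt hx hj hz
    have h3 : carlemanMult lam u x = 0 := by simp [carlemanMult, h1, h2]
    fin_cases j <;> simp_all [carlemanFlux]
  have hbottom : ∀ x ∈ Icc lo hi, x 2 = lo 2 → carlemanFlux lam u 2 x = 0 := by
    intro x hx hx2
    have hz : ∀ y ∈ Icc lo hi, y 2 = x 2 → u y = 0 :=
      fun y hy hy2 => hlow y hy 2 (hy2.trans hx2)
    have h0 : pd 0 u x = 0 := pd_eq_zero_of_slice hu1 hlt hx (j := 2) (by decide) hz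
    have h1 : pd 1 u x = 0 := pd_eq_zero_of_slice hu1 hlt hx (j := 2) (by decide) hz
    simp [carlemanFlux, carlemanVert, h0, h1, hz x hx rfl, hbot x hx hx2]
  have hvan : ∀ (i : Fin 3) (c : ℝ), c ∈ Icc (lo i) (hi i) →
      (∀ x ∈ Icc lo hi, x i = c → carlemanFlux lam u i x = 0) →
      ∫ y in Icc (lo ∘ i.succAbove) (hi ∘ i.succAbove),
        carlemanFlux lam u i (i.insertNth c y) = 0 := by
    intro i c hc h
    refine setIntegral_eq_zero_of_forall_eq_zero fun y hy => h _ (hmem i c hc y hy) ?_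
    simp
  rw [Fin.sum_univ_three,
    hvan 0 _ (right_mem_Icc.2 (hle 0)) fun x hx h => hside 0 (by decide) x hx (.inr h),
    hvan 0 _ (left_mem_Icc.2 (hle 0)) fun x hx h => hside 0 (by decide) x hx (.inl h),
    hvan 1 _ (right_mem_Icc.2 (hle 1)) fun x hx h => hside 1 (by decide) x hx (.inr h),
    hvan 1 _ (left_mem_Icc.2 (hle 1)) fun x hx h => hside 1 (by decide) x hx (.inl h),
    hvan 2 _ (left_mem_Icc.2 (hle 2)) hbottom] at hdiv
  have htop : -(lam * Real.exp (lam * (hi 2 - 1) ^ 2) *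
      ∫ y in face, B ((2 : Fin 3).insertNth (hi 2) y)) ≤
      ∫ y in face, carlemanFlux lam u 2 ((2 : Fin 3).insertNth (hi 2) y) := by
    have cI : Continuous fun y : Fin 2 → ℝ =>
        ((2 : Fin 3).insertNth (α := fun _ => ℝ) (hi 2) y) := by fun_prop
    rw [← neg_mul, ← integral_const_mul]
    refine setIntegral_mono_on ((continuous_const.mul (cB.comp cI)).continuousOn.integrableOn_Icc)
      (((cF 2).comp cI).continuousOn.integrableOn_Icc) measurableSet_Icc fun y _ => ?_
    set x : Fin 3 → ℝ := (2 : Fin 3).insertNth (hi 2) y with hx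
    have hx2 : x 2 = hi 2 := by simp [hx]
    have h := neg_carlemanVert_le (by linarith : 0 ≤ lam) u (x := x)
      (hx2 ▸ hlo.trans (hle 2)) (hx2 ▸ hhi)
    have h' := mul_le_mul_of_nonneg_left h (Real.exp_pos (lam * (hi 2 - 1) ^ 2)).le
    have e : carlemanFlux lam u 2 x =
        Real.exp (lam * (hi 2 - 1) ^ 2) * carlemanVert lam u x := by
      simp [carlemanFlux, carlemanWeight, hx2]
    rw [e]
    simp only [B]
    linarith
  have hS : Continuous fun x => carlemanWeight lam x *
      (lam / 2 * (∑ i, pd i u x ^ 2) + lam ^ 2 * u x ^ 2) := by fun_prop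
  have hmain : ∫ x in Icc lo hi, (carlemanWeight lam x *
      (lam / 2 * (∑ i, pd i u x ^ 2) + lam ^ 2 * u x ^ 2)
        + ∑ i, pd i (carlemanFlux lam u i) x) ≤
      ∫ x in Icc lo hi, carlemanWeight lam x * lap u x ^ 2 :=
    setIntegral_mono_on ((hInt hS).add (hInt cD)) (hInt (by fun_prop)) measurableSet_Icc
      fun x hx => carleman_pointwise hlam hu ((hx.2 2).trans hhi)
  rw [integral_add (hInt hS) (hInt cD)] at hmain
  have hdiv' : ∫ x in Icc lo hi, ∑ i, pd i (carlemanFlux lam u i) x =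
      ∫ y in face, carlemanFlux lam u 2 ((2 : Fin 3).insertNth (hi 2) y) := by
    refine hdiv.trans ?_
    simp [face]
  linarith

/-- Unique continuation on a box for systems with `|Δh| ≤ C |∇h|`. -/
lemma eqOn_zero_of_lap_le {N : ℕ} {h : Fin N → (Fin 3 → ℝ) → ℝ}
    (hu : ∀ k, ContDiff ℝ 3 (h k)) {lo hi : Fin 3 → ℝ}
    (hlt : ∀ i, lo i < hi i) (hlo : 0 ≤ lo 2) (hhi : hi 2 ≤ 1 / 2)
    (hlow : ∀ k, ∀ x ∈ Icc lo hi, ∀ i, x i = lo i → h k x = 0)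
    (hupp : ∀ k, ∀ x ∈ Icc lo hi, ∀ i, i ≠ 2 → x i = hi i → h k x = 0)
    (hbot : ∀ k, ∀ x ∈ Icc lo hi, x 2 = lo 2 → pd 2 (h k) x = 0) {K : ℝ}
    (hK : ∀ x ∈ Icc lo hi, ∑ k, lap (h k) x ^ 2 ≤ K * ∑ k, ∑ i, pd i (h k) x ^ 2) :
    ∀ k, ∀ x ∈ Icc lo hi, h k x = 0 := by
  choose C hC using fun k => carleman_estimate (hu k) hlt hlo hhi (hlow k) (hupp k) (hbot k)
  have cU : ∀ k, Continuous (h k) := fun k => (hu k).continuous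
  have cP : ∀ k i, Continuous (pd i (h k)) :=
    fun k i => (contDiff_pd (hu k) (m := 2) (by norm_num) i).continuous
  have cL : ∀ k, Continuous (lap (h k)) := fun k => continuous_lap ((hu k).of_le (by norm_num))
  have hInt : ∀ {g : (Fin 3 → ℝ) → ℝ}, Continuous g → IntegrableOn g (Icc lo hi) :=
    fun hg => hg.continuousOn.integrableOn_Icc
  let H : (Fin 3 → ℝ) → ℝ := fun x => ∑ k, h k x ^ 2
  have cH : Continuous H := by fun_prop
  have hH0 : ∀ x, 0 ≤ H x := fun x => Finset.sum_nonneg fun k _ => sq_nonneg _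
  have hbound : ∀ lam, max 12 (2 * K) ≤ lam → lam * ∫ x in Icc lo hi, H x ≤ ∑ k, C k := by
    intro lam hlam
    have h12 : 12 ≤ lam := (le_max_left _ _).trans hlam
    have hlK : K ≤ lam / 2 := by linarith [(le_max_right _ _).trans hlam]
    have hl0 : 0 < lam := by linarith
    have cW : Continuous (carlemanWeight lam) := (contDiff_carlemanWeight lam).continuous
    set E := Real.exp (lam * (hi 2 - 1) ^ 2) with hE
    have hE0 : 0 < E := Real.exp_pos _
    have hsum := Finset.sum_le_sum fun k (_ : k ∈ Finset.univ) => hC k lam h12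
    have cS : ∀ k, Continuous fun x => carlemanWeight lam x *
      (lam / 2 * (∑ i, pd i (h k) x ^ 2) + lam ^ 2 * h k x ^ 2) := by fun_prop
    have cR : ∀ k, Continuous fun x => carlemanWeight lam x * lap (h k) x ^ 2 := by fun_prop
    rw [Finset.sum_add_distrib, ← integral_finsetSum _ fun k _ => hInt (cS k),
      ← integral_finsetSum _ fun k _ => hInt (cR k), ← Finset.mul_sum] at hsum
    have hcmp : ∫ x in Icc lo hi, (lam ^ 2 * E * H x + ∑ k, carlemanWeight lam x * lap (h k) x ^ 2)
        ≤ ∫ x in Icc lo hi, ∑ k, carlemanWeight lam x *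
          (lam / 2 * (∑ i, pd i (h k) x ^ 2) + lam ^ 2 * h k x ^ 2) := by
      refine setIntegral_mono_on (hInt (by fun_prop)) (hInt (by fun_prop)) measurableSet_Icc
        fun x hx => ?_
      rw [← Finset.mul_sum, ← Finset.mul_sum, Finset.sum_add_distrib, ← Finset.mul_sum,
        ← Finset.mul_sum]
      have hW0 : 0 < carlemanWeight lam x := Real.exp_pos _
      have hWE : E ≤ carlemanWeight lam x := by
        refine Real.exp_le_exp.2 (mul_le_mul_of_nonneg_left ?_ hl0.le)
        have := hx.2 2
        nlinarith
      have hG0 : 0 ≤ ∑ k, ∑ i, pd i (h k) x ^ 2 :=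
        Finset.sum_nonneg fun k _ => Finset.sum_nonneg fun i _ => sq_nonneg _
      have h1 := (hK x hx).trans (mul_le_mul_of_nonneg_right hlK hG0)
      have h2 := mul_le_mul_of_nonneg_left h1 hW0.le
      have h3 := mul_le_mul_of_nonneg_right hWE
        (mul_nonneg (sq_nonneg lam) (hH0 x))
      simp only [H] at h3 ⊢
      linarith
    rw [integral_add (hInt (by fun_prop)) (hInt (by fun_prop)), integral_const_mul] at hcmp
    have h4 : lam * E * (lam * ∫ x in Icc lo hi, H x) ≤ lam * E * ∑ k, C k := by linarith
    exact le_of_mul_le_mul_left h4 (by positivity)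
  have hI0 : ∫ x in Icc lo hi, H x = 0 := by
    refine le_antisymm (le_of_not_gt fun hpos => ?_) (setIntegral_nonneg measurableSet_Icc
      fun x _ => hH0 x)
    have h1 := hbound (max (max 12 (2 * K)) ((∑ k, C k + 1) / ∫ x in Icc lo hi, H x))
      (le_max_left _ _)
    have h2 := mul_le_mul_of_nonneg_right (le_max_right (max 12 (2 * K))
      ((∑ k, C k + 1) / ∫ x in Icc lo hi, H x)) hpos.le
    rw [div_mul_cancel₀ _ hpos.ne'] at h2
    linarith
  have hae := (setIntegral_eq_zero_iff_of_nonneg_ae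
    (Filter.Eventually.of_forall hH0) (hInt cH)).1 hI0
  have hcl : Icc lo hi ⊆ closure (interior (Icc lo hi)) := by
    rw [← pi_univ_Icc, interior_pi_set finite_univ]
    simp only [interior_Icc, closure_pi_set]
    refine pi_mono fun i _ => ?_
    rw [closure_Ioo (hlt i).ne]
  have hz := Measure.eqOn_of_ae_eq hae cH.continuousOn continuousOn_const hcl
  intro k x hx
  have := (Finset.sum_eq_zero_iff_of_nonneg fun k _ => sq_nonneg (h k x)).1 (hz hx) k
    (Finset.mem_univ k)
  exact pow_eq_zero_iff (two_ne_zero) |>.1 this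

lemma Omega3_eq_pi (A : ℝ) :
    Omega3 A = Set.pi univ fun i => Ioo ((![-A, -A, 0] : Fin 3 → ℝ) i)
      ((![A, A, 1 / 2] : Fin 3 → ℝ) i) := by
  ext x
  simp [Omega3, Fin.forall_fin_succ]

lemma closure_Omega3 {A : ℝ} (hA : 0 < A) :
    closure (Omega3 A) = Icc ![-A, -A, 0] ![A, A, 1 / 2] := by
  rw [Omega3_eq_pi, closure_pi_set, ← pi_univ_Icc]
  refine pi_congr rfl fun i _ => closure_Ioo ?_
  fin_cases i <;> simp <;> linarith

lemma isOpen_Omega3 (A : ℝ) : IsOpen (Omega3 A) := by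
  rw [Omega3_eq_pi]
  exact isOpen_set_pi finite_univ fun i _ => isOpen_Ioo

/-- Difference of the quadratic nonlinearities, controlled by the gradient of the difference. -/
lemma sum_sq_Fmap_sub_le {N : ℕ} (Fc : Fin N → Fin N → Fin N → ℝ)
    {Q P : Fin N → (Fin 3 → ℝ) → ℝ} {M : ℝ} {x : Fin 3 → ℝ}
    (hQ : ∀ k i, |pd i (Q k) x| ≤ M) (hP : ∀ k i, |pd i (P k) x| ≤ M) :
    ∑ k, (Fmap Fc Q k x - Fmap Fc P k x) ^ 2 ≤
      (∑ k, (∑ m, ∑ n, |Fc k m n| * (6 * M)) ^ 2) *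
        ∑ k, ∑ i, (pd i (Q k) x - pd i (P k) x) ^ 2 := by
  set S := ∑ k, ∑ i, (pd i (Q k) x - pd i (P k) x) ^ 2 with hS
  have hS0 : 0 ≤ S := Finset.sum_nonneg fun k _ => Finset.sum_nonneg fun i _ => sq_nonneg _
  have hd : ∀ k i, |pd i (Q k) x - pd i (P k) x| ≤ √S := by
    intro k i
    refine Real.abs_le_sqrt ?_
    refine (Finset.single_le_sum (f := fun i => (pd i (Q k) x - pd i (P k) x) ^ 2)
      (fun i _ => sq_nonneg _) (Finset.mem_univ i)).trans ?_
    exact Finset.single_le_sum (f := fun k => ∑ i, (pd i (Q k) x - pd i (P k) x) ^ 2)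
      (fun k _ => Finset.sum_nonneg fun i _ => sq_nonneg _) (Finset.mem_univ k)
  rw [Finset.sum_mul]
  refine Finset.sum_le_sum fun k _ => ?_
  have hk : |Fmap Fc Q k x - Fmap Fc P k x| ≤ (∑ m, ∑ n, |Fc k m n| * (6 * M)) * √S := by
    simp only [Fmap, ← Finset.sum_sub_distrib, ← mul_sub, Finset.sum_mul]
    refine (Finset.abs_sum_le_sum_abs _ _).trans (Finset.sum_le_sum fun m _ => ?_)
    refine (Finset.abs_sum_le_sum_abs _ _).trans (Finset.sum_le_sum fun n _ => ?_)
    rw [abs_mul, mul_assoc]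
    refine mul_le_mul_of_nonneg_left ?_ (abs_nonneg _)
    refine (Finset.abs_sum_le_sum_abs _ _).trans ?_
    have hi : ∀ i ∈ Finset.univ, |pd i (Q m) x * pd i (Q n) x - pd i (P m) x * pd i (P n) x| ≤
        2 * (M * √S) := by
      intro i _
      have e : pd i (Q m) x * pd i (Q n) x - pd i (P m) x * pd i (P n) x =
          pd i (Q n) x * (pd i (Q m) x - pd i (P m) x) +
          pd i (P m) x * (pd i (Q n) x - pd i (P n) x) := by ring
      rw [e]
      refine (abs_add_le _ _).trans ?_
      rw [abs_mul, abs_mul]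
      have h1 := mul_le_mul (hQ n i) (hd m i) (abs_nonneg _) ((abs_nonneg _).trans (hQ n i))
      have h2 := mul_le_mul (hP m i) (hd n i) (abs_nonneg _) ((abs_nonneg _).trans (hP m i))
      linarith
    refine (Finset.sum_le_sum hi).trans (le_of_eq ?_)
    simp
    ring
  calc (Fmap Fc Q k x - Fmap Fc P k x) ^ 2
      = |Fmap Fc Q k x - Fmap Fc P k x| ^ 2 := (sq_abs _).symm
    _ ≤ ((∑ m, ∑ n, |Fc k m n| * (6 * M)) * √S) ^ 2 := by gcongr
    _ = (∑ m, ∑ n, |Fc k m n| * (6 * M)) ^ 2 * S := by rw [mul_pow, Real.sq_sqrt hS0]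

lemma exists_bound_pd {N : ℕ} {Q : Fin N → (Fin 3 → ℝ) → ℝ} (hQ : ∀ k, ContDiff ℝ 1 (Q k))
    (lo hi : Fin 3 → ℝ) : ∃ M, ∀ x ∈ Icc lo hi, ∀ k i, |pd i (Q k) x| ≤ M := by
  have hc : Continuous fun x => ∑ k, ∑ i, |pd i (Q k) x| :=
    continuous_finsetSum _ fun k _ => continuous_finsetSum _ fun i _ =>
      (contDiff_pd (hQ k) (m := 0) (by norm_num) i).continuous.abs
  obtain ⟨M, hM⟩ := isCompact_Icc.exists_bound_of_continuousOn (s := Icc lo hi) hc.continuousOn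
  refine ⟨M, fun x hx k i => le_trans ?_ ((le_abs_self _).trans (hM x hx))⟩
  refine (Finset.single_le_sum (f := fun i => |pd i (Q k) x|)
    (fun i _ => abs_nonneg _) (Finset.mem_univ i)).trans ?_
  exact Finset.single_le_sum (f := fun k => ∑ i, |pd i (Q k) x|)
    (fun k _ => Finset.sum_nonneg fun i _ => abs_nonneg _) (Finset.mem_univ k)

lemma eqOn_closure_Omega3 {N : ℕ} {A : ℝ} {Fc : Fin N → Fin N → Fin N → ℝ}
    {Q : Fin N → (Fin 3 → ℝ) → ℝ} (hQ : ∀ k, ContDiff ℝ 3 (Q k))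
    (hE : ∀ k, ∀ x ∈ Omega3 A, lap (Q k) x + Fmap Fc Q k x = 0) (k : Fin N) {x : Fin 3 → ℝ}
    (hx : x ∈ closure (Omega3 A)) : lap (Q k) x = -Fmap Fc Q k x := by
  have cP : ∀ k i, Continuous (pd i (Q k)) :=
    fun k i => (contDiff_pd (hQ k) (m := 2) (by norm_num) i).continuous
  have cL : Continuous (lap (Q k)) := continuous_lap ((hQ k).of_le (by norm_num))
  have cF : Continuous (Fmap Fc Q k) := by
    unfold Fmap
    fun_prop
  have hcl : IsClosed {x | lap (Q k) x + Fmap Fc Q k x = 0} :=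
    isClosed_eq (cL.add cF) continuous_const
  exact eq_neg_of_add_eq_zero_left (closure_minimal (fun y hy => hE k y hy) hcl hx)

/-- **Corollary 1, uniqueness.**
There is at most one `Q ∈ G(R,Φ,Ψ)` with `ΔQ + F(∇Q) = 0` in `Ω`
(the boundary conditions being part of the definition of `G`). -/
theorem uniqueness_3d (A R : ℝ) (N : ℕ)
    (Fc : Fin N → Fin N → Fin N → ℝ) (Φ Ψ : Fin N → (Fin 3 → ℝ) → ℝ)
    (hA : 0 < A) (hR : 0 < R) (hN : 1 ≤ N) :
    ∀ Q1 ∈ GSet N A R Φ Ψ, ∀ Q2 ∈ GSet N A R Φ Ψ,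
      (∀ k, ∀ x ∈ Omega3 A, lap (Q1 k) x + Fmap Fc Q1 k x = 0) →
      (∀ k, ∀ x ∈ Omega3 A, lap (Q2 k) x + Fmap Fc Q2 k x = 0) →
      ∀ k, ∀ x ∈ Omega3 A, Q1 k x = Q2 k x := by
  intro Q1 hQ1 Q2 hQ2 hE1 hE2 k x hx
  obtain ⟨hs1, -, hD1, hN1⟩ := hQ1
  obtain ⟨hs2, -, hD2, hN2⟩ := hQ2
  obtain ⟨a, hxa, ha⟩ := exists_between hx.2.2.2
  have ha0 : 0 < a := hx.2.2.1.trans hxa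
  set lo : Fin 3 → ℝ := ![-A, -A, 0] with hlo
  set hi : Fin 3 → ℝ := ![A, A, a] with hhi
  have hlt : ∀ i, lo i < hi i := by
    intro i
    fin_cases i <;> simp [hlo, hhi] <;> linarith
  have hcl : ∀ y ∈ Icc lo hi, y ∈ closure (Omega3 A) := by
    intro y hy
    rw [closure_Omega3 hA]
    refine ⟨hy.1, hy.2.trans fun i => ?_⟩
    fin_cases i <;> simp [hhi]
    linarith
  have hbd : ∀ y ∈ Icc lo hi, y ∉ Omega3 A → y ∈ Gamma1 A ∪ Gamma3 A := by
    intro y hy hyO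
    have hfr : y ∈ frontier (Omega3 A) := by
      rw [(isOpen_Omega3 A).frontier_eq]
      exact ⟨hcl y hy, hyO⟩
    by_cases h : y ∈ Gamma1 A
    · exact .inl h
    · refine .inr ⟨hfr, ?_⟩
      rintro (h' | h')
      · exact h h'
      · have h1 : y 2 ≤ a := hy.2 2
        linarith [h'.2]
  have hout : ∀ y, ∀ i, (y i = lo i ∨ (i ≠ 2 ∧ y i = hi i)) → y ∉ Omega3 A := by
    intro y i h hyO
    obtain ⟨h0, h1, h2⟩ := hyO
    fin_cases i <;> simp [hlo, hhi] at h
    · rcases h with h | h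
      · linarith [h0.1]
      · linarith [h0.2]
    · rcases h with h | h
      · linarith [h1.1]
      · linarith [h1.2]
    · linarith [h2.1]
  have hzero : ∀ k, ∀ y ∈ Icc lo hi, y ∉ Omega3 A → Q1 k y - Q2 k y = 0 := by
    intro k y hy hyO
    rw [hD1 k y (hbd y hy hyO), hD2 k y (hbd y hy hyO), sub_self]
  have hs1' : ∀ k, ContDiff ℝ 1 (Q1 k) := fun k => (hs1 k).of_le (by norm_num)
  have hs2' : ∀ k, ContDiff ℝ 1 (Q2 k) := fun k => (hs2 k).of_le (by norm_num)
  obtain ⟨M1, hM1⟩ := exists_bound_pd hs1' lo hi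
  obtain ⟨M2, hM2⟩ := exists_bound_pd hs2' lo hi
  refine sub_eq_zero.1 (eqOn_zero_of_lap_le (h := fun k x => Q1 k x - Q2 k x)
    (K := ∑ k, (∑ m, ∑ n, |Fc k m n| * (6 * max M1 M2)) ^ 2)
    (fun k => (hs1 k).sub (hs2 k)) hlt le_rfl ha.le
    (fun k y hy i h => hzero k y hy (hout y i (.inl h)))
    (fun k y hy i hi2 h => hzero k y hy (hout y i (.inr ⟨hi2, h⟩))) ?_ ?_ k x ?_)
  · intro k y hy hy2
    have hG : y ∈ Gamma1 A := by
      refine ⟨?_, hy2⟩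
      rw [(isOpen_Omega3 A).frontier_eq]
      exact ⟨hcl y hy, hout y 2 (.inl hy2)⟩
    rw [pd_sub (hs1' k) (hs2' k)]
    linarith [hN1 k y hG, hN2 k y hG]
  · intro y hy
    have h := sum_sq_Fmap_sub_le Fc
      (fun k i => (hM1 y hy k i).trans (le_max_left M1 M2))
      (fun k i => (hM2 y hy k i).trans (le_max_right M1 M2))
    simp only [pd_sub (hs1' _) (hs2' _)]
    refine le_trans (le_of_eq (Finset.sum_congr rfl fun k _ => ?_)) h
    rw [lap_sub ((hs1 k).of_le (by norm_num)) ((hs2 k).of_le (by norm_num)),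
      eqOn_closure_Omega3 hs1 hE1 k (hcl y hy), eqOn_closure_Omega3 hs2 hE2 k (hcl y hy)]
    ring
  · obtain ⟨h0, h1, h2⟩ := hx
    refine ⟨fun i => ?_, fun i => ?_⟩
    · fin_cases i <;> simp [hlo] <;> linarith [h0.1, h1.1, h2.1]
    · fin_cases i <;> simp [hhi] <;> linarith [h0.2, h1.2]


end
end

section
/- There exists a number C₂ = C₂(b) > 0 depending only on b such that for every function u ∈ H²(0,b) and every λ > 1: ∫₀^b (u″)² e^{−2λx} dx + C₂[λ(u′(0))² + λ³ u(0)²] ≥ C₂ ∫₀^b [(u″)² + λ(u′)² + λ³u²] e^{−2λx} dx. -/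
noncomputable section

open MeasureTheory Real Set

/-- Pointwise inequality behind the Carleman estimate: `v₀`, `v₁`, `v₂` stand for the values of a
function and its first two derivatives, and the last bracket is the derivative of
`(11/20 l² u² + 11/20 l u u' + 33/40 u'²) e^{-2lx}` divided by the weight. -/
lemma carleman_pointwise_s6 {l : ℝ} (hl : 1 ≤ l) (v₀ v₁ v₂ : ℝ) :
    v₂ ^ 2 + l * v₁ ^ 2 + l ^ 3 * v₀ ^ 2 ≤
      9 * v₂ ^ 2 -
        (11 / 10 * l ^ 2 * v₀ * v₁ + 11 / 20 * l * (v₁ * v₁ + v₀ * v₂) + 33 / 20 * v₁ * v₂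
          - 2 * l * (11 / 20 * l ^ 2 * v₀ ^ 2 + 11 / 20 * l * v₀ * v₁ + 33 / 40 * v₁ ^ 2)) := by
  have h : 0 ≤ (l - 1) * ((l * v₀) ^ 2 + v₁ ^ 2) := by
    have := sub_nonneg.2 hl
    positivity
  nlinarith [sq_nonneg (l * v₀ - 11 / 4 * v₂), sq_nonneg (v₁ - 33 / 4 * v₂), sq_nonneg v₂]

/-- The boundary quadratic form of the Carleman estimate is bounded by the boundary data. -/
lemma carleman_boundary_le {l : ℝ} (hl : 1 ≤ l) (v₀ v₁ : ℝ) :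
    11 / 20 * l ^ 2 * v₀ ^ 2 + 11 / 20 * l * v₀ * v₁ + 33 / 40 * v₁ ^ 2 ≤
      l * v₁ ^ 2 + l ^ 3 * v₀ ^ 2 := by
  have h : 0 ≤ (l - 1) * ((l * v₀) ^ 2 + v₁ ^ 2) := by
    have := sub_nonneg.2 hl
    positivity
  nlinarith [sq_nonneg (l * v₀ - 11 / 18 * v₁), sq_nonneg v₁]

/-- The boundary quadratic form of the Carleman estimate is nonnegative. -/
lemma carleman_boundary_nonneg (l v₀ v₁ : ℝ) :
    0 ≤ 11 / 20 * l ^ 2 * v₀ ^ 2 + 11 / 20 * l * v₀ * v₁ + 33 / 40 * v₁ ^ 2 := by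
  nlinarith [sq_nonneg (l * v₀ + 1 / 2 * v₁), sq_nonneg v₁]

/-- **Lemma 2, 1-d Carleman estimate, weighted form.**
There is `C₂ = C₂(b) > 0` such that for every `u ∈ H²(0,b)` and every `λ > 1`:
`∫₀^b (u″)² e^{-2λx} dx + C₂[λ(u′(0))² + λ³u(0)²]
  ≥ C₂ ∫₀^b [(u″)² + λ(u′)² + λ³u²] e^{-2λx} dx`. -/
theorem carleman_estimate_1d (b : ℝ) (hb : 0 < b) :
    ∃ C2 > (0:ℝ), ∀ u : ℝ → ℝ, ContDiff ℝ 2 u → ∀ lam > (1:ℝ),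
      (∫ x in Ioo (0:ℝ) b, (deriv (deriv u) x)^2 * Real.exp (-2 * lam * x))
        + C2 * (lam * (deriv u 0)^2 + lam^3 * (u 0)^2)
      ≥ C2 * ∫ x in Ioo (0:ℝ) b,
          ((deriv (deriv u) x)^2 + lam * (deriv u x)^2 + lam^3 * (u x)^2)
            * Real.exp (-2 * lam * x) := by
  refine ⟨1 / 9, by norm_num, fun u hu l hl => ?_⟩
  have hu' : ContDiff ℝ 1 (deriv u) := hu.deriv'
  have d0 : ∀ x, HasDerivAt u (deriv u x) x := fun x =>
    (hu.differentiable (by norm_num) x).hasDerivAt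
  have d1 : ∀ x, HasDerivAt (deriv u) (deriv (deriv u) x) x := fun x =>
    (hu'.differentiable (by norm_num) x).hasDerivAt
  have c0 : Continuous u := hu.continuous
  have c1 : Continuous (deriv u) := hu'.continuous
  have c2 : Continuous (deriv (deriv u)) := hu'.continuous_deriv le_rfl
  set Q : ℝ → ℝ := fun x => 11 / 20 * l ^ 2 * u x ^ 2 + 11 / 20 * l * u x * deriv u x
    + 33 / 40 * deriv u x ^ 2 with hQ
  set G' : ℝ → ℝ := fun x => (11 / 10 * l ^ 2 * u x * deriv u x
    + 11 / 20 * l * (deriv u x * deriv u x + u x * deriv (deriv u) x)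
    + 33 / 20 * deriv u x * deriv (deriv u) x - 2 * l * Q x) * exp (-2 * l * x) with hG'
  have hQc : Continuous Q := by fun_prop
  have hG'c : Continuous G' := by fun_prop
  have hderiv : ∀ x, HasDerivAt (fun y => Q y * exp (-2 * l * y)) (G' x) x := by
    intro x
    have he : HasDerivAt (fun y => exp (-2 * l * y)) (exp (-2 * l * x) * (-2 * l)) x := by
      simpa using ((hasDerivAt_id x).const_mul (-2 * l)).exp
    have hq := ((((d0 x).pow 2).const_mul (11 / 20 * l ^ 2)).add
      (((d0 x).const_mul (11 / 20 * l)).mul (d1 x))).add (((d1 x).pow 2).const_mul (33 / 40))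
    refine (hq.mul he).congr_deriv ?_
    simp only [hG', hQ, Pi.add_apply, Pi.mul_apply, Pi.pow_apply]
    push_cast
    ring
  have hftc : ∫ x in (0 : ℝ)..b, G' x = Q b * exp (-2 * l * b) - Q 0 := by
    rw [intervalIntegral.integral_eq_sub_of_hasDerivAt (fun x _ => hderiv x)
      (hG'c.intervalIntegrable _ _)]
    simp
  have hmono : ∫ x in (0 : ℝ)..b, ((deriv (deriv u) x)^2 + l * (deriv u x)^2 + l^3 * (u x)^2)
        * exp (-2 * l * x)
      ≤ ∫ x in (0 : ℝ)..b, (9 * ((deriv (deriv u) x)^2 * exp (-2 * l * x)) - G' x) := by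
    refine intervalIntegral.integral_mono_on hb.le (Continuous.intervalIntegrable (by fun_prop) _ _)
      (Continuous.intervalIntegrable (by fun_prop) _ _) fun x _ => ?_
    have := mul_le_mul_of_nonneg_right
      (carleman_pointwise_s6 hl.le (u x) (deriv u x) (deriv (deriv u) x)) (exp_pos (-2 * l * x)).le
    simp only [hG', hQ]
    linarith
  rw [intervalIntegral.integral_sub (Continuous.intervalIntegrable (by fun_prop) _ _)
    (hG'c.intervalIntegrable _ _), intervalIntegral.integral_const_mul, hftc] at hmono
  have hb0 : 0 ≤ Q b * exp (-2 * l * b) :=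
    mul_nonneg (carleman_boundary_nonneg _ _ _) (exp_pos _).le
  have h0 : Q 0 ≤ l * deriv u 0 ^ 2 + l ^ 3 * u 0 ^ 2 := carleman_boundary_le hl.le _ _
  simp only [← integral_Ioc_eq_integral_Ioo, ← intervalIntegral.integral_of_le hb.le]
  linarith

end
end

section
/- There exists a number C₂ = C₂(b) > 0 depending only on b such that for every function u ∈ H²(0,b) and every λ > 1: ∫₀^b (u″)² e^{−2λx} dx + C₂[λ(u′(0))² + λ³ u(0)²] ≥ C₂ e^{−2λb} ‖u‖²_{H²(0,b)}. -/
noncomputable section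

open MeasureTheory Real Set

theorem contDiff_one_deriv {u : ℝ → ℝ} (hu : ContDiff ℝ 2 u) : ContDiff ℝ 1 (deriv u) :=
  (hu.of_le (by norm_num) : ContDiff ℝ (1 + 1) u).deriv'

/-- Cauchy-Schwarz for increments: the squared increment of a `C¹` function over `[0, x]` is at most
`x` times the integral of the squared derivative. -/
theorem sq_sub_le_mul_integral_deriv_sq {f : ℝ → ℝ} (hf : ContDiff ℝ 1 f) {x : ℝ} (hx : 0 ≤ x) :
    (f x - f 0)^2 ≤ x * ∫ t in (0:ℝ)..x, (deriv f t)^2 := by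
  rcases hx.eq_or_lt with rfl | hx
  · simp
  have hc : Continuous (deriv f) := hf.continuous_deriv le_rfl
  have hftc : ∫ t in (0:ℝ)..x, deriv f t = f x - f 0 :=
    intervalIntegral.integral_deriv_eq_sub
      (fun t _ => (hf.differentiable one_ne_zero).differentiableAt) (hc.intervalIntegrable _ _)
  set m := (f x - f 0) / x with hm
  have hnonneg : 0 ≤ ∫ t in (0:ℝ)..x, (deriv f t - m)^2 :=
    intervalIntegral.integral_nonneg hx.le fun t _ => sq_nonneg _
  have hexpand : ∫ t in (0:ℝ)..x, (deriv f t - m)^2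
      = (∫ t in (0:ℝ)..x, (deriv f t)^2) - 2 * m * (f x - f 0) + x * m^2 := by
    have h : ∀ t, (deriv f t - m)^2 = (deriv f t)^2 - 2 * m * deriv f t + m^2 :=
      fun t => by ring
    simp_rw [h]
    rw [intervalIntegral.integral_add (Continuous.intervalIntegrable (by fun_prop) _ _)
        (Continuous.intervalIntegrable (by fun_prop) _ _),
      intervalIntegral.integral_sub (Continuous.intervalIntegrable (by fun_prop) _ _)
        (Continuous.intervalIntegrable (by fun_prop) _ _),
      intervalIntegral.integral_const_mul, hftc]
    simp
  have hD : f x - f 0 = x * m := by rw [hm]; field_simp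
  rw [hexpand, hD] at hnonneg
  rw [hD]
  nlinarith

/-- The increment bound over `[0, x]` in terms of the integral over a longer interval `[0, b]`. -/
theorem sq_sub_le_mul_integral_deriv_sq_of_mem {f : ℝ → ℝ} (hf : ContDiff ℝ 1 f) {b x : ℝ}
    (hx : x ∈ Icc 0 b) :
    (f x - f 0)^2 ≤ b * ∫ t in (0:ℝ)..b, (deriv f t)^2 := by
  have hc : Continuous (deriv f) := hf.continuous_deriv le_rfl
  refine (sq_sub_le_mul_integral_deriv_sq hf hx.1).trans ?_
  refine mul_le_mul hx.2 ?_
    (intervalIntegral.integral_nonneg hx.1 fun t _ => sq_nonneg _) (hx.1.trans hx.2)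
  exact intervalIntegral.integral_mono_interval le_rfl hx.1 hx.2
    (Filter.Eventually.of_forall fun t => sq_nonneg _)
    (Continuous.intervalIntegrable (by fun_prop) _ _)

/-- The squared first-order Taylor remainder on `[0, b]` is controlled by the integral of the squared
second derivative. -/
theorem sq_taylor_remainder_le {u : ℝ → ℝ} (hu : ContDiff ℝ 2 u) {b x : ℝ} (hx : x ∈ Icc 0 b) :
    (u x - u 0 - deriv u 0 * x)^2 ≤ b^3 * ∫ t in (0:ℝ)..b, (deriv (deriv u) t)^2 := by
  have hb : 0 ≤ b := hx.1.trans hx.2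
  have hu' : ContDiff ℝ 1 (deriv u) := contDiff_one_deriv hu
  have hg : ContDiff ℝ 1 (fun t => u t - deriv u 0 * t) :=
    (hu.of_le one_le_two).sub (contDiff_const.mul contDiff_id)
  have hg' : ∀ t, deriv (fun t => u t - deriv u 0 * t) t = deriv u t - deriv u 0 := fun t => by
    have h := ((hu.differentiable two_ne_zero).differentiableAt (x := t)).hasDerivAt.sub
      ((hasDerivAt_id t).const_mul (deriv u 0))
    exact h.deriv.trans (by rw [mul_one])
  have h := sq_sub_le_mul_integral_deriv_sq_of_mem hg hx
  simp only [hg', mul_zero, sub_zero] at h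
  have hint : ∫ t in (0:ℝ)..b, (deriv u t - deriv u 0)^2
      ≤ ∫ _t in (0:ℝ)..b, b * ∫ s in (0:ℝ)..b, (deriv (deriv u) s)^2 := by
    have := hu'.continuous
    exact intervalIntegral.integral_mono_on hb (Continuous.intervalIntegrable (by fun_prop) _ _)
      intervalIntegrable_const fun t ht => sq_sub_le_mul_integral_deriv_sq_of_mem hu' ht
  rw [intervalIntegral.integral_const, smul_eq_mul, sub_zero] at hint
  calc (u x - u 0 - deriv u 0 * x)^2 = (u x - deriv u 0 * x - u 0)^2 := by ring
    _ ≤ _ := h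
    _ ≤ b * (b * (b * ∫ s in (0:ℝ)..b, (deriv (deriv u) s)^2)) := by gcongr
    _ = _ := by ring

/-- The `H²(0,b)` norm is controlled by the second derivative and the Cauchy data at `0`. -/
theorem integral_sq_add_deriv_sq_le {u : ℝ → ℝ} (hu : ContDiff ℝ 2 u) {b : ℝ} (hb : 0 ≤ b) :
    ∫ x in (0:ℝ)..b, ((u x)^2 + (deriv u x)^2 + (deriv (deriv u) x)^2)
      ≤ 3 * b * (u 0)^2 + (3 * b^3 + 2 * b) * (deriv u 0)^2
        + (1 + 2 * b^2 + 3 * b^4) * ∫ x in (0:ℝ)..b, (deriv (deriv u) x)^2 := by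
  have hu' : ContDiff ℝ 1 (deriv u) := contDiff_one_deriv hu
  have hc0 := hu.continuous
  have hc1 := hu'.continuous
  have hc2 : Continuous (deriv (deriv u)) := hu'.continuous_deriv le_rfl
  set J := ∫ x in (0:ℝ)..b, (deriv (deriv u) x)^2 with hJ
  have hpt : ∀ x ∈ Icc 0 b, (u x)^2 + (deriv u x)^2
      ≤ 3 * (u 0)^2 + (3 * b^2 + 2) * (deriv u 0)^2 + (2 * b + 3 * b^3) * J := by
    intro x hx
    have h1 := sq_sub_le_mul_integral_deriv_sq_of_mem hu' hx
    have h2 := sq_taylor_remainder_le hu hx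
    have h3 : (deriv u 0 * x)^2 ≤ b^2 * (deriv u 0)^2 := by
      rw [mul_pow, mul_comm]
      gcongr
      exacts [hx.1, hx.2]
    rw [← hJ] at h1 h2
    have h4 : (u x)^2 ≤ 3 * ((u 0)^2 + (deriv u 0 * x)^2 + (u x - u 0 - deriv u 0 * x)^2) := by
      linarith [sq_nonneg (u 0 - deriv u 0 * x),
        sq_nonneg (u 0 - (u x - u 0 - deriv u 0 * x)),
        sq_nonneg (deriv u 0 * x - (u x - u 0 - deriv u 0 * x))]
    have h5 : (deriv u x)^2 ≤ 2 * ((deriv u 0)^2 + (deriv u x - deriv u 0)^2) := by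
      linarith [sq_nonneg (deriv u 0 - (deriv u x - deriv u 0))]
    linarith
  have hint := intervalIntegral.integral_mono_on hb
    (Continuous.intervalIntegrable (μ := volume) (by fun_prop) _ _) intervalIntegrable_const hpt
  rw [intervalIntegral.integral_const, smul_eq_mul, sub_zero] at hint
  rw [intervalIntegral.integral_add (Continuous.intervalIntegrable (by fun_prop) _ _)
    (Continuous.intervalIntegrable (by fun_prop) _ _), ← hJ]
  linarith

/-- Both coefficients of the Cauchy data are absorbed by the exponential. -/
theorem cauchy_data_coeff_le_exp {b : ℝ} (hb : 0 ≤ b) :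
    3 * b ≤ exp (2 * b) ∧ 3 * b^3 + 2 * b ≤ exp (2 * b) := by
  have h := sum_le_exp_of_nonneg (by positivity : 0 ≤ 2 * b) 5
  norm_num [Finset.sum_range_succ, Nat.factorial] at h
  have h3 : 0 ≤ b^3 := by positivity
  have h4 : 0 ≤ b^4 := by positivity
  constructor
  · nlinarith [sq_nonneg (b - 1)]
  · nlinarith [mul_nonneg (sq_nonneg b) (sq_nonneg (4 * b - 5)), sq_nonneg b]

/-- **Lemma 2, 1-d Carleman estimate, `H²` form.**
There is `C₂ = C₂(b) > 0` such that for every `u ∈ H²(0,b)` and every `λ > 1`: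
`∫₀^b (u″)² e^{-2λx} dx + C₂[λ(u′(0))² + λ³u(0)²] ≥ C₂ e^{-2λb} ‖u‖²_{H²(0,b)}`. -/
theorem carleman_estimate_1d_H2 (b : ℝ) (hb : 0 < b) :
    ∃ C2 > (0:ℝ), ∀ u : ℝ → ℝ, ContDiff ℝ 2 u → ∀ lam > (1:ℝ),
      (∫ x in Ioo (0:ℝ) b, (deriv (deriv u) x)^2 * Real.exp (-2 * lam * x))
        + C2 * (lam * (deriv u 0)^2 + lam^3 * (u 0)^2)
      ≥ C2 * Real.exp (-2 * lam * b) *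
          ∫ x in Ioo (0:ℝ) b, ((u x)^2 + (deriv u x)^2 + (deriv (deriv u) x)^2) := by
  have hK : 0 < 1 + 2 * b^2 + 3 * b^4 := by positivity
  refine ⟨(1 + 2 * b^2 + 3 * b^4)⁻¹, inv_pos.mpr hK, fun u hu lam hlam => ?_⟩
  have hc2 : Continuous (deriv (deriv u)) := (contDiff_one_deriv hu).continuous_deriv le_rfl
  simp only [← integral_Ioc_eq_integral_Ioo, ← intervalIntegral.integral_of_le hb.le]
  have hH := integral_sq_add_deriv_sq_le hu hb.le
  set K := 1 + 2 * b^2 + 3 * b^4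
  set J := ∫ x in (0:ℝ)..b, (deriv (deriv u) x)^2
  set E := Real.exp (-2 * lam * b) with hE
  have hE0 : 0 < E := Real.exp_pos _
  have hweight : E * J ≤ ∫ x in (0:ℝ)..b, (deriv (deriv u) x)^2 * Real.exp (-2 * lam * x) := by
    rw [← intervalIntegral.integral_const_mul]
    refine intervalIntegral.integral_mono_on hb.le
      (Continuous.intervalIntegrable (by fun_prop) _ _)
      (Continuous.intervalIntegrable (by fun_prop) _ _) fun x hx => ?_
    rw [mul_comm]
    refine mul_le_mul_of_nonneg_left (Real.exp_le_exp.mpr ?_) (sq_nonneg _)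
    nlinarith [hx.2]
  have habsorb : ∀ c, c ≤ Real.exp (2 * b) → E * c ≤ 1 := fun c hc => by
    calc E * c ≤ E * Real.exp (2 * b) := by gcongr
      _ = Real.exp (-2 * lam * b + 2 * b) := (Real.exp_add _ _).symm
      _ ≤ 1 := Real.exp_le_one_iff.mpr (by nlinarith)
  obtain ⟨hc0, hc1⟩ := cauchy_data_coeff_le_exp hb.le
  have h0 : E * (3 * b) * (u 0)^2 ≤ lam^3 * (u 0)^2 := by
    gcongr
    exact (habsorb _ hc0).trans (one_le_pow₀ hlam.le)
  have h1 : E * (3 * b^3 + 2 * b) * (deriv u 0)^2 ≤ lam * (deriv u 0)^2 := by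
    gcongr
    exact (habsorb _ hc1).trans hlam.le
  have hmain := mul_le_mul_of_nonneg_left hH hE0.le
  rw [ge_iff_le, mul_assoc]
  calc K⁻¹ * (E * ∫ x in (0:ℝ)..b, ((u x)^2 + (deriv u x)^2 + (deriv (deriv u) x)^2))
      ≤ K⁻¹ * (K * (E * J) + (lam * (deriv u 0)^2 + lam^3 * (u 0)^2)) := by
        gcongr
        linarith
    _ = E * J + K⁻¹ * (lam * (deriv u 0)^2 + lam^3 * (u 0)^2) := by
        rw [mul_add, inv_mul_cancel_left₀ hK.ne']
    _ ≤ _ := by gcongr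

end
end

section
/- There exists a sufficiently large number λ₂ = λ₂(G₁,F) > 1 depending only on G₁ and F such that for all λ ≥ λ₂ the functional J̄_λ(Q) = ∫₀^b [Q″ + F(Q′)]² e^{−2λx} dx is strictly convex on the set G₁; namely, there exists a constant C₃ = C₃(G₁,F) > 0 depending only on G₁ and F such that for all Q₁, Q₂ ∈ G₁: J̄_λ(Q₂) − J̄_λ(Q₁) − J̄′_λ(Q₁)(Q₂−Q₁) ≥ C₃ e^{−2λb} ‖Q₂−Q₁‖²_{H²(0,b)}, where J̄′_λ(Q₁) is the Fréchet derivative of J̄_λ at Q₁. -/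
noncomputable section

open MeasureTheory Real Set

/-- `F_k(Q′) = Σ_{m,n} F_{kmn} q_m′ q_n′`. -/
def F1 {N : ℕ} (Fc : Fin N → Fin N → Fin N → ℝ) (Q : Fin N → ℝ → ℝ)
    (k : Fin N) (x : ℝ) : ℝ :=
  ∑ m, ∑ n, Fc k m n * (deriv (Q m) x * deriv (Q n) x)

/-- The directional derivative `F′(Q′)h′`, `k`-th component. -/
def F1dir {N : ℕ} (Fc : Fin N → Fin N → Fin N → ℝ) (Q h : Fin N → ℝ → ℝ)
    (k : Fin N) (x : ℝ) : ℝ :=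
  ∑ m, ∑ n, Fc k m n *
    (deriv (h m) x * deriv (Q n) x + deriv (Q m) x * deriv (h n) x)

/-- Squared `H²(0,b)` norm of a vector function (`ℓ²` combination of components). -/
def h2Sq1d (b : ℝ) {N : ℕ} (Q : Fin N → ℝ → ℝ) : ℝ :=
  ∑ k, ∫ x in Ioo (0:ℝ) b,
    ((Q k x)^2 + (deriv (Q k) x)^2 + (deriv (deriv (Q k)) x)^2)

/-- The set `G₁(R,Φ₀,Ψ₀,Ψ_b)` (with `H²(0,b)` membership modelled by `C²` smoothness). -/
def G1Set (N : ℕ) (b R : ℝ) (Φ0 Ψ0 Ψb : Fin N → ℝ) : Set (Fin N → ℝ → ℝ) :=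
  {Q | (∀ k, ContDiff ℝ 2 (Q k)) ∧
       Real.sqrt (h2Sq1d b Q) < R ∧
       (∀ k, Q k 0 = Φ0 k) ∧ (∀ k, deriv (Q k) 0 = Ψ0 k) ∧
       (∀ k, deriv (Q k) b = Ψb k)}

/-- The 1-d weighted functional `J̄_λ(Q) = ∫₀^b [Q″ + F(Q′)]² e^{-2λx} dx`. -/
def Jbar (b lam : ℝ) {N : ℕ} (Fc : Fin N → Fin N → Fin N → ℝ)
    (Q : Fin N → ℝ → ℝ) : ℝ :=
  ∫ x in Ioo (0:ℝ) b,
    (∑ k, (deriv (deriv (Q k)) x + F1 Fc Q k x)^2) * Real.exp (-2 * lam * x)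

/-- The Fréchet derivative of `J̄_λ` at `Q` applied to `h`. -/
def JbarDeriv (b lam : ℝ) {N : ℕ} (Fc : Fin N → Fin N → Fin N → ℝ)
    (Q h : Fin N → ℝ → ℝ) : ℝ :=
  ∫ x in Ioo (0:ℝ) b,
    (2 * ∑ k, (deriv (deriv (Q k)) x + F1 Fc Q k x)
        * (deriv (deriv (h k)) x + F1dir Fc Q h k x)) * Real.exp (-2 * lam * x)

theorem setIntegral_Ioo_eq_intervalIntegral {b : ℝ} (hb : 0 ≤ b) (f : ℝ → ℝ) :
    ∫ x in Ioo (0:ℝ) b, f x = ∫ x in (0:ℝ)..b, f x := by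
  rw [intervalIntegral.integral_of_le hb, integral_Ioc_eq_integral_Ioo]

/-- Carleman estimate for `d/dx` with the weight `e^{-2λx}`, for functions vanishing at `0`. -/
theorem carleman_estimate_s8 {p p' : ℝ → ℝ} (hp : ∀ x, HasDerivAt p (p' x) x)
    (hp' : Continuous p') (h0 : p 0 = 0) {lam : ℝ} (hlam : 0 < lam) {x : ℝ} (hx : 0 ≤ x) :
    p x ^ 2 * exp (-2 * lam * x) + lam * ∫ t in (0:ℝ)..x, p t ^ 2 * exp (-2 * lam * t)
      ≤ lam⁻¹ * ∫ t in (0:ℝ)..x, p' t ^ 2 * exp (-2 * lam * t) := by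
  have hpc : Continuous p := continuous_iff_continuousAt.2 fun t => (hp t).continuousAt
  have hderiv : ∀ t, HasDerivAt (fun t => p t ^ 2 * exp (-2 * lam * t))
      ((2 * p t * p' t - 2 * lam * p t ^ 2) * exp (-2 * lam * t)) t := by
    intro t
    have h1 : HasDerivAt (fun t : ℝ => exp (-2 * lam * t))
        (exp (-2 * lam * t) * (-2 * lam * 1)) t :=
      ((hasDerivAt_id t).const_mul (-2 * lam)).exp
    refine (((hp t).pow 2).mul h1).congr_deriv ?_
    simp only [Nat.cast_ofNat, Pi.pow_apply]
    ring
  have hftc := intervalIntegral.integral_eq_sub_of_hasDerivAt (a := 0) (b := x)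
    (fun t _ => hderiv t) (Continuous.intervalIntegrable (by fun_prop) _ _)
  have hx2 : p x ^ 2 * exp (-2 * lam * x) =
      ∫ t in (0:ℝ)..x, (2 * p t * p' t - 2 * lam * p t ^ 2) * exp (-2 * lam * t) := by
    rw [hftc, h0]; simp
  rw [hx2, ← intervalIntegral.integral_const_mul, ← intervalIntegral.integral_const_mul,
    ← intervalIntegral.integral_add (Continuous.intervalIntegrable (by fun_prop) _ _)
      (Continuous.intervalIntegrable (by fun_prop) _ _)]
  refine intervalIntegral.integral_mono_on hx (Continuous.intervalIntegrable (by fun_prop) _ _)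
    (Continuous.intervalIntegrable (by fun_prop) _ _) fun t _ => ?_
  have hsq : 2 * p t * p' t - lam * p t ^ 2 ≤ lam⁻¹ * p' t ^ 2 := by
    have : lam⁻¹ * p' t ^ 2 - (2 * p t * p' t - lam * p t ^ 2)
        = lam⁻¹ * (p' t - lam * p t) ^ 2 := by
      field_simp
      ring
    have : 0 ≤ lam⁻¹ * (p' t - lam * p t) ^ 2 := by positivity
    linarith
  have := mul_le_mul_of_nonneg_right hsq (exp_pos (-2 * lam * t)).le
  linarith

theorem integral_le_integral_of_nonneg {f : ℝ → ℝ} (hf : Continuous f) (hnn : ∀ t, 0 ≤ f t)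
    {x b : ℝ} (hx : x ∈ Icc 0 b) : ∫ t in (0:ℝ)..x, f t ≤ ∫ t in (0:ℝ)..b, f t :=
  intervalIntegral.integral_mono_interval le_rfl hx.1 hx.2 (ae_of_all _ hnn)
    (hf.intervalIntegrable _ _)

theorem sq_mul_exp_le {p p' : ℝ → ℝ} (hp : ∀ x, HasDerivAt p (p' x) x)
    (hp' : Continuous p') (h0 : p 0 = 0) {lam : ℝ} (hlam : 0 < lam) {b x : ℝ}
    (hx : x ∈ Icc 0 b) :
    p x ^ 2 * exp (-2 * lam * x)
      ≤ lam⁻¹ * ∫ t in (0:ℝ)..b, p' t ^ 2 * exp (-2 * lam * t) := by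
  have h1 := carleman_estimate_s8 hp hp' h0 hlam hx.1
  have h2 := integral_le_integral_of_nonneg
    (f := fun t => p' t ^ 2 * exp (-2 * lam * t)) (by fun_prop) (fun t => by positivity) hx
  have h3 : 0 ≤ ∫ t in (0:ℝ)..x, p t ^ 2 * exp (-2 * lam * t) :=
    intervalIntegral.integral_nonneg hx.1 fun t _ => by positivity
  have h4 := mul_le_mul_of_nonneg_left h2 (inv_pos.2 hlam).le
  have h5 := mul_nonneg hlam.le h3
  linarith

theorem integral_sq_mul_exp_le {p p' : ℝ → ℝ} (hp : ∀ x, HasDerivAt p (p' x) x)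
    (hp' : Continuous p') (h0 : p 0 = 0) {lam : ℝ} (hlam : 1 ≤ lam) {b : ℝ} (hb : 0 ≤ b) :
    ∫ t in (0:ℝ)..b, p t ^ 2 * exp (-2 * lam * t)
      ≤ lam⁻¹ * ∫ t in (0:ℝ)..b, p' t ^ 2 * exp (-2 * lam * t) := by
  have h1 := carleman_estimate_s8 hp hp' h0 (zero_lt_one.trans_le hlam) hb
  have h3 : 0 ≤ ∫ t in (0:ℝ)..b, p t ^ 2 * exp (-2 * lam * t) :=
    intervalIntegral.integral_nonneg hb fun t _ => by positivity
  have h4 : 0 ≤ p b ^ 2 * exp (-2 * lam * b) := by positivity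
  nlinarith

theorem integral_sq_mul_exp_le_integral_sq {f : ℝ → ℝ} (hf : Continuous f) {lam b : ℝ}
    (hlam : 0 ≤ lam) (hb : 0 ≤ b) :
    ∫ t in (0:ℝ)..b, f t ^ 2 * exp (-2 * lam * t) ≤ ∫ t in (0:ℝ)..b, f t ^ 2 := by
  refine intervalIntegral.integral_mono_on hb (Continuous.intervalIntegrable (by fun_prop) _ _)
    (Continuous.intervalIntegrable (by fun_prop) _ _) fun t ht => ?_
  exact mul_le_of_le_one_right (sq_nonneg _) (exp_le_one_iff.2 (by nlinarith [ht.1]))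

theorem exp_mul_integral_le {f : ℝ → ℝ} (hf : Continuous f) (hnn : ∀ t, 0 ≤ f t) {lam b : ℝ}
    (hlam : 0 ≤ lam) (hb : 0 ≤ b) :
    exp (-2 * lam * b) * ∫ t in (0:ℝ)..b, f t
      ≤ ∫ t in (0:ℝ)..b, f t * exp (-2 * lam * t) := by
  rw [← intervalIntegral.integral_const_mul]
  refine intervalIntegral.integral_mono_on hb (Continuous.intervalIntegrable (by fun_prop) _ _)
    (Continuous.intervalIntegrable (by fun_prop) _ _) fun t ht => ?_
  rw [mul_comm]
  exact mul_le_mul_of_nonneg_left (exp_le_exp.2 (by nlinarith [ht.2])) (hnn t)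

theorem sq_le_exp_mul_integral {p p' : ℝ → ℝ} (hp : ∀ x, HasDerivAt p (p' x) x)
    (hp' : Continuous p') (h0 : p 0 = 0) {b x : ℝ} (hx : x ∈ Icc 0 b) :
    p x ^ 2 ≤ exp (2 * b) * ∫ t in (0:ℝ)..b, p' t ^ 2 := by
  have hb : 0 ≤ b := hx.1.trans hx.2
  have h1 := sq_mul_exp_le hp hp' h0 one_pos hx
  have h2 := integral_sq_mul_exp_le_integral_sq hp' zero_le_one hb
  have h3 : p x ^ 2 * exp (-2 * 1 * b) ≤ p x ^ 2 * exp (-2 * 1 * x) :=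
    mul_le_mul_of_nonneg_left (exp_le_exp.2 (by linarith [hx.2])) (sq_nonneg _)
  have h4 : p x ^ 2 * exp (-2 * 1 * b) ≤ ∫ t in (0:ℝ)..b, p' t ^ 2 := by
    rw [inv_one, one_mul] at h1
    linarith
  have h5 : p x ^ 2 = exp (2 * b) * (p x ^ 2 * exp (-2 * 1 * b)) := by
    rw [mul_left_comm, ← exp_add]; simp
  rw [h5]
  exact mul_le_mul_of_nonneg_left h4 (exp_pos _).le

/-- Poincaré inequality on `(0, b)` for functions vanishing at `0`. -/
theorem integral_sq_le_exp_mul_integral {p p' : ℝ → ℝ} (hp : ∀ x, HasDerivAt p (p' x) x)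
    (hp' : Continuous p') (h0 : p 0 = 0) {b : ℝ} (hb : 0 ≤ b) :
    ∫ t in (0:ℝ)..b, p t ^ 2 ≤ exp (2 * b) * ∫ t in (0:ℝ)..b, p' t ^ 2 := by
  have hpc : Continuous p := continuous_iff_continuousAt.2 fun t => (hp t).continuousAt
  have h1 := integral_sq_mul_exp_le hp hp' h0 le_rfl hb
  have h2 := integral_sq_mul_exp_le_integral_sq hp' zero_le_one hb
  have h3 := exp_mul_integral_le (f := fun t => p t ^ 2) (by fun_prop)
    (fun t => sq_nonneg _) zero_le_one hb
  have h5 : ∫ t in (0:ℝ)..b, p t ^ 2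
      = exp (2 * b) * (exp (-2 * 1 * b) * ∫ t in (0:ℝ)..b, p t ^ 2) := by
    rw [← mul_assoc, ← exp_add]; simp
  rw [inv_one, one_mul] at h1
  rw [h5]
  exact mul_le_mul_of_nonneg_left (by linarith) (exp_pos _).le

theorem abs_sum_sum_le {N : ℕ} (c : Fin N → Fin N → ℝ) (z : Fin N → Fin N → ℝ) {B : ℝ}
    (hz : ∀ m n, |z m n| ≤ B) : |∑ m, ∑ n, c m n * z m n| ≤ (∑ m, ∑ n, |c m n|) * B := by
  rw [Finset.sum_mul]
  refine (Finset.abs_sum_le_sum_abs _ _).trans (Finset.sum_le_sum fun m _ => ?_)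
  rw [Finset.sum_mul]
  refine (Finset.abs_sum_le_sum_abs _ _).trans (Finset.sum_le_sum fun n _ => ?_)
  rw [abs_mul]
  exact mul_le_mul_of_nonneg_left (hz m n) (abs_nonneg _)

theorem abs_le_sqrt_sum_sq {N : ℕ} (p : Fin N → ℝ) (m : Fin N) :
    |p m| ≤ √(∑ i, p i ^ 2) :=
  abs_le_sqrt (Finset.single_le_sum (f := fun i => p i ^ 2) (fun _ _ => sq_nonneg _)
    (Finset.mem_univ m))

/-- Pointwise lower bound for the second-order remainder of `(v + B(u, u))²`, where `B` is the
bilinear form with coefficients `c`. -/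
theorem remainder_ge {N : ℕ} (c : Fin N → Fin N → ℝ) (u p : Fin N → ℝ) {v a K M : ℝ}
    (hK : ∑ m, ∑ n, |c m n| ≤ K) (hM : ∀ m, |u m| ≤ M) (hM' : ∀ m, |u m + p m| ≤ M)
    (hM0 : 0 ≤ M) :
    a ^ 2 / 2 - ((6 * K ^ 2 * M ^ 2 + K) * ∑ m, p m ^ 2) - K * (∑ m, p m ^ 2) * v ^ 2 ≤
      (v + a + ∑ m, ∑ n, c m n * ((u m + p m) * (u n + p n))) ^ 2
      - (v + ∑ m, ∑ n, c m n * (u m * u n)) ^ 2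
      - 2 * ((v + ∑ m, ∑ n, c m n * (u m * u n))
        * (a + ∑ m, ∑ n, c m n * (p m * u n + u m * p n))) := by
  set P := ∑ m, p m ^ 2 with hP
  have hP0 : 0 ≤ P := Finset.sum_nonneg fun _ _ => sq_nonneg _
  have hK0 : 0 ≤ K := (Finset.sum_nonneg fun _ _ => Finset.sum_nonneg fun _ _ =>
    abs_nonneg _).trans hK
  have hpm := abs_le_sqrt_sum_sq p
  rw [← hP] at hpm
  have hs := sqrt_nonneg P
  have hss : √P * √P = P := mul_self_sqrt hP0
  set U := ∑ m, ∑ n, c m n * (u m * u n) with hU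
  set d := ∑ m, ∑ n, c m n * (p m * u n + u m * p n) with hd
  set f := ∑ m, ∑ n, c m n * (p m * p n) with hf
  have hexp : ∑ m, ∑ n, c m n * ((u m + p m) * (u n + p n)) = U + d + f := by
    simp only [hU, hd, hf, ← Finset.sum_add_distrib]
    exact Finset.sum_congr rfl fun m _ => Finset.sum_congr rfl fun n _ => by ring
  have hdf : d + f = ∑ m, ∑ n, c m n * (p m * (u n + p n) + u m * p n) := by
    simp only [hd, hf, ← Finset.sum_add_distrib]
    exact Finset.sum_congr rfl fun m _ => Finset.sum_congr rfl fun n _ => by ring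
  have hUle : |U| ≤ K * (M * M) := by
    refine (abs_sum_sum_le c _ fun m n => ?_).trans
      (mul_le_mul_of_nonneg_right hK (mul_nonneg hM0 hM0))
    rw [abs_mul]
    exact mul_le_mul (hM m) (hM n) (abs_nonneg _) hM0
  have hfle : |f| ≤ K * P := by
    refine (abs_sum_sum_le c _ fun m n => ?_).trans (mul_le_mul_of_nonneg_right hK hP0)
    rw [abs_mul, ← hss]
    exact mul_le_mul (hpm m) (hpm n) (abs_nonneg _) hs
  have hdfle : |d + f| ≤ K * (2 * M * √P) := by
    rw [hdf]
    refine (abs_sum_sum_le c _ fun m n => ?_).trans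
      (mul_le_mul_of_nonneg_right hK (by positivity))
    refine (abs_add_le _ _).trans ?_
    rw [abs_mul, abs_mul]
    have h1 := mul_le_mul (hpm m) (hM' n) (abs_nonneg _) hs
    have h2 := mul_le_mul (hM m) (hpm n) (abs_nonneg _) hM0
    linarith
  have hsq : (d + f) ^ 2 ≤ 4 * K ^ 2 * M ^ 2 * P := by
    calc (d + f) ^ 2 = |d + f| ^ 2 := (sq_abs _).symm
      _ ≤ (K * (2 * M * √P)) ^ 2 := pow_le_pow_left₀ (abs_nonneg _) hdfle 2
      _ = 4 * K ^ 2 * M ^ 2 * (√P * √P) := by ring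
      _ = 4 * K ^ 2 * M ^ 2 * P := by rw [hss]
  have hUf : |U * f| ≤ K * (M * M) * (K * P) := by
    rw [abs_mul]
    exact mul_le_mul hUle hfle (abs_nonneg _) (by positivity)
  have hvf : |v * f| ≤ |v| * (K * P) := by
    rw [abs_mul]
    exact mul_le_mul_of_nonneg_left hfle (abs_nonneg _)
  have hv : |v| * (K * P) ≤ (1 + v ^ 2) / 2 * (K * P) :=
    mul_le_mul_of_nonneg_right (by nlinarith [sq_nonneg (|v| - 1), sq_abs v])
      (mul_nonneg hK0 hP0)
  rw [hexp]
  have h1 := (abs_le.1 hUf).1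
  have h2 := (abs_le.1 hvf).1
  nlinarith [sq_nonneg (a + 2 * (d + f))]

theorem hasDerivAt_deriv_of_contDiff_two {q : ℝ → ℝ} (hq : ContDiff ℝ 2 q) :
    (∀ x, HasDerivAt q (deriv q x) x) ∧ (∀ x, HasDerivAt (deriv q) (deriv (deriv q) x) x) ∧
      Continuous (deriv q) ∧ Continuous (deriv (deriv q)) := by
  have h1 : ContDiff ℝ 1 (deriv q) := hq.deriv' (n := 1)
  refine ⟨fun x => (hq.differentiable (by norm_num) x).hasDerivAt,
    fun x => (h1.differentiable (by norm_num) x).hasDerivAt, h1.continuous, ?_⟩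
  exact h1.continuous_deriv le_rfl

theorem sum_integral_deriv_deriv_sq_le {N : ℕ} {b : ℝ} (hb : 0 ≤ b) {Q : Fin N → ℝ → ℝ}
    (hQ : ∀ k, ContDiff ℝ 2 (Q k)) :
    ∑ k, ∫ x in (0:ℝ)..b, deriv (deriv (Q k)) x ^ 2 ≤ h2Sq1d b Q := by
  refine Finset.sum_le_sum fun k _ => ?_
  obtain ⟨h1, h2, h3, h4⟩ := hasDerivAt_deriv_of_contDiff_two (hQ k)
  have h0 := (hQ k).continuous
  rw [setIntegral_Ioo_eq_intervalIntegral hb]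
  refine intervalIntegral.integral_mono_on hb (Continuous.intervalIntegrable (by fun_prop) _ _)
    (Continuous.intervalIntegrable (by fun_prop) _ _) fun x _ => ?_
  nlinarith [sq_nonneg (Q k x), sq_nonneg (deriv (Q k) x)]

theorem h2Sq1d_le {N : ℕ} {b : ℝ} (hb : 0 ≤ b) {h : Fin N → ℝ → ℝ}
    (hh : ∀ k, ContDiff ℝ 2 (h k)) (h0 : ∀ k, h k 0 = 0) (h0' : ∀ k, deriv (h k) 0 = 0) :
    h2Sq1d b h ≤ (1 + exp (2 * b) + exp (2 * b) ^ 2) *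
      ∑ k, ∫ x in (0:ℝ)..b, deriv (deriv (h k)) x ^ 2 := by
  rw [Finset.mul_sum]
  refine Finset.sum_le_sum fun k _ => ?_
  obtain ⟨h1, h2, h3, h4⟩ := hasDerivAt_deriv_of_contDiff_two (hh k)
  have hc := (hh k).continuous
  rw [setIntegral_Ioo_eq_intervalIntegral hb,
    intervalIntegral.integral_add (Continuous.intervalIntegrable (by fun_prop) _ _)
      (Continuous.intervalIntegrable (by fun_prop) _ _),
    intervalIntegral.integral_add (Continuous.intervalIntegrable (by fun_prop) _ _)
      (Continuous.intervalIntegrable (by fun_prop) _ _)]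
  have i1 := integral_sq_le_exp_mul_integral h1 h3 (h0 k) hb
  have i2 := integral_sq_le_exp_mul_integral h2 h4 (h0' k) hb
  have i3 := mul_le_mul_of_nonneg_left i2 (exp_pos (2 * b)).le
  linarith

theorem exp_mul_h2Sq1d_le {N : ℕ} {b lam : ℝ} (hb : 0 ≤ b) (hlam : 0 ≤ lam)
    {h : Fin N → ℝ → ℝ} (hh : ∀ k, ContDiff ℝ 2 (h k)) (h0 : ∀ k, h k 0 = 0)
    (h0' : ∀ k, deriv (h k) 0 = 0) :
    exp (-2 * lam * b) * h2Sq1d b h ≤ (1 + exp (2 * b) + exp (2 * b) ^ 2) *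
      ∫ x in (0:ℝ)..b, (∑ k, deriv (deriv (h k)) x ^ 2) * exp (-2 * lam * x) := by
  have c := fun k => (hasDerivAt_deriv_of_contDiff_two (hh k)).2.2.2
  have hexp := exp_mul_integral_le (f := fun x => ∑ k, deriv (deriv (h k)) x ^ 2)
    (by fun_prop) (fun x => Finset.sum_nonneg fun k _ => sq_nonneg _) hlam hb
  rw [intervalIntegral.integral_finsetSum fun k _ =>
    Continuous.intervalIntegrable (by fun_prop) _ _] at hexp
  refine (mul_le_mul_of_nonneg_left (h2Sq1d_le hb hh h0 h0') (exp_pos _).le).trans ?_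
  rw [mul_left_comm]
  exact mul_le_mul_of_nonneg_left hexp (by positivity)

/-- Membership in `G₁` bounds the first derivatives uniformly. -/
theorem abs_deriv_le_of_mem_G1Set {N : ℕ} {b R : ℝ} {Φ0 Ψ0 Ψb : Fin N → ℝ} (hR : 0 < R)
    {Q : Fin N → ℝ → ℝ} (hQ : Q ∈ G1Set N b R Φ0 Ψ0 Ψb) {x : ℝ} (hx : x ∈ Icc 0 b)
    (k : Fin N) : |deriv (Q k) x| ≤ (∑ i, |Ψ0 i|) + √(exp (2 * b) * R ^ 2) := by
  obtain ⟨hc, hn, -, hd, -⟩ := hQ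
  have hb : 0 ≤ b := hx.1.trans hx.2
  obtain ⟨-, h2, -, h4⟩ := hasDerivAt_deriv_of_contDiff_two (hc k)
  have hnorm := (sqrt_lt' hR).1 hn
  have hsum := sum_integral_deriv_deriv_sq_le hb hc
  have hk := Finset.single_le_sum (f := fun i => ∫ x in (0:ℝ)..b, deriv (deriv (Q i)) x ^ 2)
    (fun i _ => intervalIntegral.integral_nonneg hb fun t _ => sq_nonneg _) (Finset.mem_univ k)
  have hp := sq_le_exp_mul_integral (p := fun t => deriv (Q k) t - Ψ0 k)
    (fun t => (h2 t).sub_const _) h4 (by simp [hd k]) hx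
  have h5 : (deriv (Q k) x - Ψ0 k) ^ 2 ≤ exp (2 * b) * R ^ 2 :=
    hp.trans (mul_le_mul_of_nonneg_left (by linarith) (exp_pos _).le)
  have h6 := abs_le_sqrt h5
  have h7 : |Ψ0 k| ≤ ∑ i, |Ψ0 i| :=
    Finset.single_le_sum (f := fun i => |Ψ0 i|) (fun i _ => abs_nonneg _) (Finset.mem_univ k)
  have h8 := abs_add_le (deriv (Q k) x - Ψ0 k) (Ψ0 k)
  rw [sub_add_cancel] at h8
  linarith

theorem deriv_add_deriv_sub {N : ℕ} {Q1 Q2 : Fin N → ℝ → ℝ}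
    (hQ1 : ∀ k, ContDiff ℝ 2 (Q1 k)) (hQ2 : ∀ k, ContDiff ℝ 2 (Q2 k)) (k : Fin N) (x : ℝ) :
    deriv (Q1 k) x + deriv ((Q2 - Q1) k) x = deriv (Q2 k) x := by
  have h : deriv ((Q2 - Q1) k) x = deriv (Q2 k) x - deriv (Q1 k) x :=
    (((hasDerivAt_deriv_of_contDiff_two (hQ2 k)).1 x).sub
      ((hasDerivAt_deriv_of_contDiff_two (hQ1 k)).1 x)).deriv
  rw [h]
  ring

/-- The integrand of the remainder `J̄(Q + h) − J̄(Q) − J̄′(Q)h`, without the weight. -/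
def remainderDensity {N : ℕ} (Fc : Fin N → Fin N → Fin N → ℝ) (Q h : Fin N → ℝ → ℝ)
    (x : ℝ) : ℝ :=
  ∑ k, ((deriv (deriv (Q k)) x + deriv (deriv (h k)) x
      + ∑ m, ∑ n, Fc k m n *
        ((deriv (Q m) x + deriv (h m) x) * (deriv (Q n) x + deriv (h n) x))) ^ 2
    - (deriv (deriv (Q k)) x + F1 Fc Q k x) ^ 2
    - 2 * ((deriv (deriv (Q k)) x + F1 Fc Q k x)
      * (deriv (deriv (h k)) x + F1dir Fc Q h k x)))

theorem Jbar_remainder_eq {N : ℕ} {b : ℝ} (hb : 0 ≤ b) (lam : ℝ)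
    (Fc : Fin N → Fin N → Fin N → ℝ) {Q1 Q2 : Fin N → ℝ → ℝ}
    (hQ1 : ∀ k, ContDiff ℝ 2 (Q1 k)) (hQ2 : ∀ k, ContDiff ℝ 2 (Q2 k)) :
    Jbar b lam Fc Q2 - Jbar b lam Fc Q1 - JbarDeriv b lam Fc Q1 (Q2 - Q1) =
      ∫ x in (0:ℝ)..b, remainderDensity Fc Q1 (Q2 - Q1) x * exp (-2 * lam * x) := by
  have hh : ∀ k, ContDiff ℝ 2 ((Q2 - Q1) k) := fun k => (hQ2 k).sub (hQ1 k)
  have c1 := fun k => (hasDerivAt_deriv_of_contDiff_two (hQ1 k)).2.2.1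
  have c1' := fun k => (hasDerivAt_deriv_of_contDiff_two (hQ1 k)).2.2.2
  have c2 := fun k => (hasDerivAt_deriv_of_contDiff_two (hQ2 k)).2.2.1
  have c2' := fun k => (hasDerivAt_deriv_of_contDiff_two (hQ2 k)).2.2.2
  have c3 := fun k => (hasDerivAt_deriv_of_contDiff_two (hh k)).2.2.1
  have c3' := fun k => (hasDerivAt_deriv_of_contDiff_two (hh k)).2.2.2
  have hd : ∀ k, deriv (Q2 k) = fun x => deriv (Q1 k) x + deriv ((Q2 - Q1) k) x :=
    fun k => funext fun x => (deriv_add_deriv_sub hQ1 hQ2 k x).symm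
  have hd' : ∀ k x, deriv (deriv (Q2 k)) x
      = deriv (deriv (Q1 k)) x + deriv (deriv ((Q2 - Q1) k)) x := by
    intro k x
    rw [hd k]
    exact (((hasDerivAt_deriv_of_contDiff_two (hQ1 k)).2.1 x).add
      ((hasDerivAt_deriv_of_contDiff_two (hh k)).2.1 x)).deriv
  unfold Jbar JbarDeriv
  simp only [setIntegral_Ioo_eq_intervalIntegral hb]
  rw [← intervalIntegral.integral_sub
      (Continuous.intervalIntegrable (by unfold F1; fun_prop) _ _)
      (Continuous.intervalIntegrable (by unfold F1; fun_prop) _ _),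
    ← intervalIntegral.integral_sub
      (Continuous.intervalIntegrable (by unfold F1; fun_prop) _ _)
      (Continuous.intervalIntegrable (by unfold F1 F1dir; fun_prop) _ _)]
  refine intervalIntegral.integral_congr fun x _ => ?_
  simp only [remainderDensity, Finset.sum_sub_distrib, ← Finset.mul_sum]
  rw [← sub_mul, ← sub_mul]
  simp only [hd', F1, deriv_add_deriv_sub hQ1 hQ2]

theorem remainderDensity_ge {N : ℕ} (Fc : Fin N → Fin N → Fin N → ℝ) (Q h : Fin N → ℝ → ℝ)
    {x M : ℝ} (hM : ∀ m, |deriv (Q m) x| ≤ M) (hM' : ∀ m, |deriv (Q m) x + deriv (h m) x| ≤ M)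
    (hM0 : 0 ≤ M) {K : ℝ} (hK : ∀ k, ∑ m, ∑ n, |Fc k m n| ≤ K) :
    (∑ k, deriv (deriv (h k)) x ^ 2) / 2
      - N * (6 * K ^ 2 * M ^ 2 + K) * (∑ m, deriv (h m) x ^ 2)
      - K * (∑ m, deriv (h m) x ^ 2) * ∑ k, deriv (deriv (Q k)) x ^ 2
      ≤ remainderDensity Fc Q h x := by
  have := Finset.sum_le_sum fun k (_ : k ∈ Finset.univ) =>
    remainder_ge (Fc k) (fun m => deriv (Q m) x) (fun m => deriv (h m) x)
      (v := deriv (deriv (Q k)) x) (a := deriv (deriv (h k)) x) (hK k) hM hM' hM0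
  refine le_trans (le_of_eq ?_) this
  simp only [Finset.sum_sub_distrib, ← Finset.mul_sum, ← Finset.sum_div, Finset.sum_const,
    Finset.card_univ, Fintype.card_fin, nsmul_eq_mul]
  ring

/-- The weighted lower bound for the remainder in terms of `∫ |h″|² e^{-2λx}`. -/
theorem integral_remainderDensity_ge {N : ℕ} {b R : ℝ} (hb : 0 ≤ b)
    (Fc : Fin N → Fin N → Fin N → ℝ) {Q h : Fin N → ℝ → ℝ}
    (hQ : ∀ k, ContDiff ℝ 2 (Q k)) (hh : ∀ k, ContDiff ℝ 2 (h k))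
    (h0 : ∀ k, deriv (h k) 0 = 0) (hR : h2Sq1d b Q ≤ R ^ 2) {M : ℝ}
    (hM : ∀ x ∈ Icc 0 b, ∀ m, |deriv (Q m) x| ≤ M)
    (hM' : ∀ x ∈ Icc 0 b, ∀ m, |deriv (Q m) x + deriv (h m) x| ≤ M)
    (hM0 : 0 ≤ M) {K : ℝ} (hK : ∀ k, ∑ m, ∑ n, |Fc k m n| ≤ K) (hK0 : 0 ≤ K) {lam : ℝ}
    (hlam : 1 ≤ lam) (hlam' : 4 * (N * (6 * K ^ 2 * M ^ 2 + K) + K * R ^ 2) ≤ lam) :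
    (∫ x in (0:ℝ)..b, (∑ k, deriv (deriv (h k)) x ^ 2) * exp (-2 * lam * x)) / 4
      ≤ ∫ x in (0:ℝ)..b, remainderDensity Fc Q h x * exp (-2 * lam * x) := by
  have hlam0 : 0 < lam := zero_lt_one.trans_le hlam
  have c1 := fun k => (hasDerivAt_deriv_of_contDiff_two (hQ k)).2.2.1
  have c1' := fun k => (hasDerivAt_deriv_of_contDiff_two (hQ k)).2.2.2
  have c2 := fun k => (hasDerivAt_deriv_of_contDiff_two (hh k)).2.2.1
  have c2' := fun k => (hasDerivAt_deriv_of_contDiff_two (hh k)).2.2.2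
  have d2 := fun k => (hasDerivAt_deriv_of_contDiff_two (hh k)).2.1
  set C := N * (6 * K ^ 2 * M ^ 2 + K) with hC
  have hC0 : 0 ≤ C := by positivity
  set A := ∫ x in (0:ℝ)..b, (∑ k, deriv (deriv (h k)) x ^ 2) * exp (-2 * lam * x) with hA
  have hA0 : 0 ≤ A := intervalIntegral.integral_nonneg hb fun x _ => by positivity
  have hAsum : A = ∑ k, ∫ x in (0:ℝ)..b, deriv (deriv (h k)) x ^ 2 * exp (-2 * lam * x) := by
    rw [hA, ← intervalIntegral.integral_finsetSum fun k _ =>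
      Continuous.intervalIntegrable (by fun_prop) _ _]
    simp only [Finset.sum_mul]
  have hsup : ∀ x ∈ Icc 0 b, (∑ m, deriv (h m) x ^ 2) * exp (-2 * lam * x) ≤ lam⁻¹ * A := by
    intro x hx
    rw [hAsum, Finset.mul_sum, Finset.sum_mul]
    exact Finset.sum_le_sum fun k _ => sq_mul_exp_le (d2 k) (c2' k) (h0 k) hlam0 hx
  have hint : ∫ x in (0:ℝ)..b, (∑ m, deriv (h m) x ^ 2) * exp (-2 * lam * x) ≤ lam⁻¹ * A := by
    simp only [Finset.sum_mul]
    rw [intervalIntegral.integral_finsetSum fun k _ =>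
      Continuous.intervalIntegrable (by fun_prop) _ _, hAsum, Finset.mul_sum]
    exact Finset.sum_le_sum fun k _ => integral_sq_mul_exp_le (d2 k) (c2' k) (h0 k) hlam hb
  have hV : ∫ x in (0:ℝ)..b, ∑ k, deriv (deriv (Q k)) x ^ 2 ≤ R ^ 2 := by
    rw [intervalIntegral.integral_finsetSum fun k _ =>
      Continuous.intervalIntegrable (by fun_prop) _ _]
    exact (sum_integral_deriv_deriv_sq_le hb hQ).trans hR
  have hlower : ∫ x in (0:ℝ)..b,
      ((1 / 2) * ((∑ k, deriv (deriv (h k)) x ^ 2) * exp (-2 * lam * x))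
        - C * ((∑ m, deriv (h m) x ^ 2) * exp (-2 * lam * x))
        - K * (lam⁻¹ * A) * ∑ k, deriv (deriv (Q k)) x ^ 2)
      ≤ ∫ x in (0:ℝ)..b, remainderDensity Fc Q h x * exp (-2 * lam * x) := by
    refine intervalIntegral.integral_mono_on hb
      (Continuous.intervalIntegrable (by fun_prop) _ _)
      (Continuous.intervalIntegrable (by unfold remainderDensity F1 F1dir; fun_prop) _ _)
      fun x hx => ?_
    have h1 := mul_le_mul_of_nonneg_right
      (remainderDensity_ge Fc Q h (hM x hx) (hM' x hx) hM0 hK) (exp_pos (-2 * lam * x)).le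
    have h2 := mul_le_mul_of_nonneg_right (mul_le_mul_of_nonneg_left (hsup x hx) hK0)
      (Finset.sum_nonneg fun k (_ : k ∈ Finset.univ) => sq_nonneg (deriv (deriv (Q k)) x))
    rw [← hC] at h1
    linarith
  rw [intervalIntegral.integral_sub (Continuous.intervalIntegrable (by fun_prop) _ _)
      (Continuous.intervalIntegrable (by fun_prop) _ _),
    intervalIntegral.integral_sub (Continuous.intervalIntegrable (by fun_prop) _ _)
      (Continuous.intervalIntegrable (by fun_prop) _ _),
    intervalIntegral.integral_const_mul, intervalIntegral.integral_const_mul,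
    intervalIntegral.integral_const_mul, ← hA] at hlower
  have e1 := mul_le_mul_of_nonneg_left hint hC0
  have e2 := mul_le_mul_of_nonneg_left hV (by positivity : 0 ≤ K * (lam⁻¹ * A))
  have e3 : (C + K * R ^ 2) * lam⁻¹ ≤ 1 / 4 := by
    rw [← div_eq_mul_inv, div_le_iff₀ hlam0]
    linarith
  have e4 := mul_le_mul_of_nonneg_right e3 hA0
  linarith

/-- **Theorem 4, strict convexity of the 1-d functional.**
There is `λ₂ = λ₂(G₁,F) > 1` and `C₃ = C₃(G₁,F) > 0` such that for all `λ ≥ λ₂`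
and all `Q₁, Q₂ ∈ G₁`:
`J̄_λ(Q₂) − J̄_λ(Q₁) − J̄′_λ(Q₁)(Q₂−Q₁) ≥ C₃ e^{-2λb} ‖Q₂−Q₁‖²_{H²(0,b)}`. -/
theorem strict_convexity_1d (b R : ℝ) (N : ℕ)
    (Fc : Fin N → Fin N → Fin N → ℝ) (Φ0 Ψ0 Ψb : Fin N → ℝ)
    (hb : 0 < b) (hR : 0 < R) (hN : 1 ≤ N) :
    ∃ lam2 > (1:ℝ), ∃ C3 > (0:ℝ), ∀ lam ≥ lam2,
      ∀ Q1 ∈ G1Set N b R Φ0 Ψ0 Ψb, ∀ Q2 ∈ G1Set N b R Φ0 Ψ0 Ψb,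
        Jbar b lam Fc Q2 - Jbar b lam Fc Q1 - JbarDeriv b lam Fc Q1 (Q2 - Q1)
          ≥ C3 * Real.exp (-2 * lam * b) * h2Sq1d b (Q2 - Q1) := by
  set M := (∑ i, |Ψ0 i|) + √(exp (2 * b) * R ^ 2) with hM
  have hM0 : 0 ≤ M := by positivity
  set K := ∑ k, ∑ m, ∑ n, |Fc k m n| with hKdef
  have hK0 : 0 ≤ K := by positivity
  have hK : ∀ k, ∑ m, ∑ n, |Fc k m n| ≤ K := fun k =>
    Finset.single_le_sum (f := fun k => ∑ m, ∑ n, |Fc k m n|)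
      (fun i _ => by positivity) (Finset.mem_univ k)
  set C := 4 * (N * (6 * K ^ 2 * M ^ 2 + K) + K * R ^ 2) with hC
  have hC0 : 0 ≤ C := by positivity
  set D := 1 + exp (2 * b) + exp (2 * b) ^ 2 with hD
  have hD0 : 0 < D := by positivity
  refine ⟨2 + C, by linarith, (4 * D)⁻¹, by positivity, fun lam hlam Q1 hQ1 Q2 hQ2 => ?_⟩
  have hh : ∀ k, ContDiff ℝ 2 ((Q2 - Q1) k) := fun k => (hQ2.1 k).sub (hQ1.1 k)
  have hadd := fun x m => deriv_add_deriv_sub hQ1.1 hQ2.1 m x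
  have h0 : ∀ k, (Q2 - Q1) k 0 = 0 := fun k => by
    simp [hQ1.2.2.1 k, hQ2.2.2.1 k]
  have h0' : ∀ k, deriv ((Q2 - Q1) k) 0 = 0 := fun k => by
    linarith [hadd 0 k, hQ1.2.2.2.1 k, hQ2.2.2.2.1 k]
  rw [ge_iff_le, Jbar_remainder_eq hb.le lam Fc hQ1.1 hQ2.1]
  have hmain := integral_remainderDensity_ge hb.le Fc hQ1.1 hh h0'
    ((sqrt_lt' hR).1 hQ1.2.1).le (fun x hx m => abs_deriv_le_of_mem_G1Set hR hQ1 hx m)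
    (fun x hx m => by rw [hadd]; exact abs_deriv_le_of_mem_G1Set hR hQ2 hx m)
    hM0 hK hK0 (lam := lam) (by linarith) (by linarith)
  refine le_trans ?_ hmain
  have hnorm := exp_mul_h2Sq1d_le hb.le (lam := lam) (by linarith) hh h0 h0'
  rw [← hD] at hnorm
  rw [mul_assoc, inv_mul_le_iff₀ (by positivity)]
  linarith

end
end

section
/- Let Z(Q) = ΔQ + F(∇Q) with Fréchet derivative Z′(Q)h = Δh + F′(∇Q)∇h. Then the map Q ↦ Z′(Q) from G(R,Φ,Ψ) to 𝓛(H₀³(Ω), L₂^{λ,ν₀}(Ω)) is Lipschitz continuous: there exists C₁ = C₁(Ω,G,F) > 0 such that for all Q₁, Q₂ ∈ G(R,Φ,Ψ) and all h ∈ H₀³(Ω), ‖Z′(Q₁)h − Z′(Q₂)h‖_{L₂^{λ,ν₀}(Ω)} ≤ C₁ e^{λξ^{−ν₀}} ‖Q₁ − Q₂‖_{H³(Ω)} ‖h‖_{H³(Ω)}. -/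
noncomputable section

open MeasureTheory Real Set

lemma ofReal_sq_le_lintegral_Ioo {u u' : ℝ → ℝ} (hu : ∀ t, HasDerivAt u (u' t) t)
    (hu' : Continuous u') {a b s : ℝ} (hs : s ∈ Ioo a b) :
    ENNReal.ofReal (u s ^ 2) ≤ ENNReal.ofReal (1 + (b - a)⁻¹) *
      ∫⁻ t in Ioo a b, ENNReal.ofReal (u t ^ 2 + u' t ^ 2) := by
  have hab : a < b := hs.1.trans hs.2
  have hcu : Continuous u := continuous_iff_continuousAt.2 fun t => (hu t).continuousAt
  have hcont : Continuous fun t => u t ^ 2 + u' t ^ 2 := by fun_prop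
  have hint (c d : ℝ) : IntervalIntegrable (fun t => u t ^ 2 + u' t ^ 2) volume c d :=
    hcont.intervalIntegrable c d
  set I := ∫ t in a..b, (u t ^ 2 + u' t ^ 2) with hI
  have hI0 : 0 ≤ I := intervalIntegral.integral_nonneg hab.le fun t _ => by positivity
  have hpt : ∀ t ∈ Icc a b, u s ^ 2 ≤ u t ^ 2 + I := by
    intro t ht
    have hftc : ∫ r in t..s, 2 * u r * u' r = u s ^ 2 - u t ^ 2 := by
      apply intervalIntegral.integral_eq_sub_of_hasDerivAt (f := fun r => u r ^ 2)
      · intro r _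
        simpa using (hu r).fun_pow 2
      · exact Continuous.intervalIntegrable (by fun_prop) _ _
    have h1 : ‖∫ r in t..s, 2 * u r * u' r‖ ≤ |∫ r in t..s, (u r ^ 2 + u' r ^ 2)| := by
      apply intervalIntegral.norm_integral_le_abs_of_norm_le _ (hint t s)
      refine Filter.Eventually.of_forall fun r => ?_
      rw [Real.norm_eq_abs, abs_le]
      constructor <;> nlinarith [sq_nonneg (u r + u' r), sq_nonneg (u r - u' r)]
    have h2 : |∫ r in t..s, (u r ^ 2 + u' r ^ 2)| ≤ |I| := by
      apply intervalIntegral.abs_integral_mono_interval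
      · rw [uIoc_of_le hab.le]
        rintro r ⟨hr1, hr2⟩
        exact ⟨(le_min ht.1 hs.1.le).trans_lt hr1, hr2.trans (max_le ht.2 hs.2.le)⟩
      · exact Filter.Eventually.of_forall fun r => by simp only [Pi.zero_apply]; positivity
      · exact hint a b
    rw [hftc, Real.norm_eq_abs] at h1
    rw [abs_of_nonneg hI0] at h2
    linarith [le_abs_self (u s ^ 2 - u t ^ 2)]
  have havg : (b - a) * u s ^ 2 ≤ I + (b - a) * I := by
    have h1 : ∫ t in a..b, u s ^ 2 ≤ ∫ t in a..b, ((u t ^ 2 + u' t ^ 2) + I) := by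
      apply intervalIntegral.integral_mono_on hab.le (by simp)
        ((hint a b).add (by simp))
      intro t ht
      nlinarith [hpt t ht, sq_nonneg (u' t)]
    rw [intervalIntegral.integral_add (hint a b) (by simp)] at h1
    simpa using h1
  have hreal : u s ^ 2 ≤ (1 + (b - a)⁻¹) * I := by
    have hL : 0 < b - a := sub_pos.2 hab
    refine le_of_mul_le_mul_left (havg.trans_eq ?_) hL
    field_simp
    ring
  have hlin : ∫⁻ t in Ioo a b, ENNReal.ofReal (u t ^ 2 + u' t ^ 2) = ENNReal.ofReal I := by
    rw [hI, intervalIntegral.integral_of_le hab.le, integral_Ioc_eq_integral_Ioo,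
      ofReal_integral_eq_lintegral_ofReal
        ((hint a b).1.mono_set Ioo_subset_Ioc_self)
        (Filter.Eventually.of_forall fun t => by simp only [Pi.zero_apply]; positivity)]
  rw [hlin, ← ENNReal.ofReal_mul (by have := sub_pos.2 hab; positivity)]
  exact ENNReal.ofReal_le_ofReal hreal

/-- The sides of the box `Omega3 A`. -/
def side (A : ℝ) (i : Fin 3) : Set ℝ := Ioo (![-A, -A, 0] i) (![A, A, 1 / 2] i)

lemma Omega3_eq_pi_s13 (A : ℝ) : Omega3 A = Set.univ.pi (side A) := by
  ext x
  simp [Omega3, side, Fin.forall_fin_succ]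

/-- Lebesgue measure on the sides of `Omega3 A`. -/
def sideMeasure (A : ℝ) (i : Fin 3) : Measure ℝ := volume.restrict (side A i)

instance (A : ℝ) (i : Fin 3) : SigmaFinite (sideMeasure A i) := by
  unfold sideMeasure; infer_instance

lemma pi_sideMeasure (A : ℝ) :
    Measure.pi (sideMeasure A) = volume.restrict (Omega3 A) := by
  rw [Omega3_eq_pi_s13, volume_pi, Measure.restrict_pi_pi]
  rfl

lemma Continuous.integrableOn_Omega3 {f : (Fin 3 → ℝ) → ℝ} (hf : Continuous f) (A : ℝ) :
    IntegrableOn f (Omega3 A) := by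
  have hK : IsCompact (Set.univ.pi fun i => Icc (![-A, -A, 0] i) (![A, A, 1 / 2] i)) :=
    isCompact_univ_pi fun i => isCompact_Icc
  refine (hf.continuousOn.integrableOn_compact hK).mono_set ?_
  rw [Omega3_eq_pi_s13]
  exact Set.pi_mono fun i _ => Ioo_subset_Icc_self

lemma contDiff_pdList {u : (Fin 3 → ℝ) → ℝ} {l : List (Fin 3)} {n : ℕ}
    (hu : ContDiff ℝ (n + l.length : ℕ) u) : ContDiff ℝ n (pdList l u) := by
  induction l generalizing n with
  | nil => simpa [pdList] using hu
  | cons i l ih =>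
    refine contDiff_pd (ih (n := n + 1) ?_) (by norm_cast) i
    rwa [List.length_cons, ← add_assoc, add_right_comm] at hu

lemma hasDerivAt_comp_update {u : (Fin 3 → ℝ) → ℝ} (hu : Differentiable ℝ u)
    (x : Fin 3 → ℝ) (i : Fin 3) (t : ℝ) :
    HasDerivAt (fun t => u (Function.update x i t)) (pd i u (Function.update x i t)) t :=
  (hu _).hasFDerivAt.comp_hasDerivAt t (hasDerivAt_update x i t)

/-- The constant of the one-dimensional Sobolev inequality on the `i`-th side of `Omega3 A`. -/
def sideConst (A : ℝ) (i : Fin 3) : ℝ := 1 + (![A, A, 1 / 2] i - ![-A, -A, 0] i)⁻¹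

lemma ofReal_sq_le_lmarginal {A : ℝ} {u : (Fin 3 → ℝ) → ℝ} (hu : ContDiff ℝ 1 u)
    {x : Fin 3 → ℝ} {i : Fin 3} (hx : x i ∈ side A i) :
    ENNReal.ofReal (u x ^ 2) ≤ ENNReal.ofReal (sideConst A i) *
      (∫⋯∫⁻_{i}, (fun y => ENNReal.ofReal (u y ^ 2 + pd i u y ^ 2)) ∂sideMeasure A) x := by
  have hc : Continuous (pd i u) := (contDiff_pd hu (m := 0) (by simp) i).continuous
  have h := ofReal_sq_le_lintegral_Ioo
    (hasDerivAt_comp_update (hu.differentiable (by simp)) x i)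
    (hc.comp (continuous_const.update i continuous_id)) hx
  rw [lmarginal_singleton]
  simpa [side, sideMeasure, sideConst] using h

lemma ofReal_sq_le_lmarginal_of_le {A : ℝ} {u D : (Fin 3 → ℝ) → ℝ} (hu : ContDiff ℝ 1 u)
    {i : Fin 3} (h0 : ∀ y, u y ^ 2 ≤ D y) (h1 : ∀ y, pd i u y ^ 2 ≤ D y)
    {x : Fin 3 → ℝ} (hx : x i ∈ side A i) :
    ENNReal.ofReal (u x ^ 2) ≤ ENNReal.ofReal (sideConst A i) * 2 *
      (∫⋯∫⁻_{i}, (fun y => ENNReal.ofReal (D y)) ∂sideMeasure A) x := by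
  refine (ofReal_sq_le_lmarginal hu hx).trans ?_
  rw [mul_assoc]
  gcongr
  simp only [lmarginal_singleton]
  rw [← lintegral_const_mul' _ _ (by simp)]
  refine lintegral_mono fun t => ?_
  rw [two_mul, ENNReal.ofReal_add (sq_nonneg _) (sq_nonneg _)]
  gcongr
  · exact h0 _
  · exact h1 _

lemma ofReal_sq_le_lmarginal_pair_of_le {A : ℝ} {u D : (Fin 3 → ℝ) → ℝ} (hu : ContDiff ℝ 2 u)
    (hD : Measurable D) {i j : Fin 3} (hij : i ≠ j)
    (h0 : ∀ y, u y ^ 2 ≤ D y) (h1 : ∀ y, pd i u y ^ 2 ≤ D y)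
    (h2 : ∀ y, pd j u y ^ 2 ≤ D y) (h3 : ∀ y, pd j (pd i u) y ^ 2 ≤ D y)
    {x : Fin 3 → ℝ} (hxi : x i ∈ side A i) (hxj : x j ∈ side A j) :
    ENNReal.ofReal (u x ^ 2) ≤
      ENNReal.ofReal (sideConst A i) * (2 * (ENNReal.ofReal (sideConst A j) * 2)) *
        (∫⋯∫⁻_{i, j}, (fun y => ENNReal.ofReal (D y)) ∂sideMeasure A) x := by
  have hu1 : ContDiff ℝ 1 u := hu.of_le (by norm_num)
  have hpd : ContDiff ℝ 1 (pd i u) := contDiff_pd hu (by norm_num) i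
  refine (ofReal_sq_le_lmarginal hu1 hxi).trans ?_
  rw [mul_assoc, lmarginal_insert _ hD.ennreal_ofReal (by simpa using hij)]
  gcongr
  rw [lmarginal_singleton, ← lintegral_const_mul' _ _ (by finiteness)]
  refine lintegral_mono fun t => ?_
  have hy : Function.update x i t j ∈ side A j := by
    rwa [Function.update_of_ne hij.symm]
  dsimp only
  rw [mul_assoc, two_mul, ENNReal.ofReal_add (sq_nonneg _) (sq_nonneg _)]
  gcongr
  · exact ofReal_sq_le_lmarginal_of_le hu1 h0 h2 hy
  · exact ofReal_sq_le_lmarginal_of_le hpd h1 h3 hy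

lemma lintegral_lmarginal_mul_lmarginal_compl {ι : Type*} [Fintype ι] [DecidableEq ι]
    {X : ι → Type*} [∀ i, MeasurableSpace (X i)] [Nonempty (∀ i, X i)]
    (μ : ∀ i, Measure (X i)) [∀ i, SigmaFinite (μ i)]
    {f g : (∀ i, X i) → ENNReal} (hf : Measurable f) (hg : Measurable g) (s : Finset ι) :
    ∫⁻ x, (∫⋯∫⁻_s, f ∂μ) x * (∫⋯∫⁻_sᶜ, g ∂μ) x ∂Measure.pi μ =
      (∫⁻ x, f x ∂Measure.pi μ) * ∫⁻ x, g x ∂Measure.pi μ := by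
  obtain ⟨x₀⟩ := ‹Nonempty (∀ i, X i)›
  have hF : Measurable (∫⋯∫⁻_s, f ∂μ) := hf.lmarginal μ
  have hG : Measurable (∫⋯∫⁻_sᶜ, g ∂μ) := hg.lmarginal μ
  have huniv : (Finset.univ : Finset ι) = sᶜ ∪ s := by
    rw [Finset.union_comm, Finset.union_compl]
  have hinner : (∫⋯∫⁻_s, (fun x => (∫⋯∫⁻_s, f ∂μ) x * (∫⋯∫⁻_sᶜ, g ∂μ) x) ∂μ) =
      fun x => (∫⋯∫⁻_s, f ∂μ) x * ∫⁻ x, g x ∂Measure.pi μ := by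
    ext x
    rw [lintegral_eq_lmarginal_univ x, ← Finset.union_compl s,
      lmarginal_union μ g hg disjoint_compl_right]
    have hconst (y : ∀ i : s, X i) :
        (∫⋯∫⁻_s, f ∂μ) (Function.updateFinset x s y) = (∫⋯∫⁻_s, f ∂μ) x :=
      lmarginal_congr μ f fun i hi => by simp [Function.updateFinset, hi]
    rw [lmarginal]
    simp only [hconst]
    exact lintegral_const_mul _ (hG.comp measurable_updateFinset)
  rw [lintegral_eq_lmarginal_univ x₀, huniv,
    lmarginal_union μ (fun x => (∫⋯∫⁻_s, f ∂μ) x * (∫⋯∫⁻_sᶜ, g ∂μ) x) (hF.mul hG)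
      disjoint_compl_left, hinner, lintegral_eq_lmarginal_univ (f := f) x₀, huniv,
    lmarginal_union μ f hf disjoint_compl_left]
  exact lintegral_mul_const _ (hF.comp measurable_updateFinset)

/-- The density of the Sobolev norm of order `k`. -/
def sobDensity (k : ℕ) (u : (Fin 3 → ℝ) → ℝ) (x : Fin 3 → ℝ) : ℝ :=
  ∑ j ∈ Finset.range (k + 1), ∑ idx : Fin j → Fin 3, pdList (List.ofFn idx) u x ^ 2

lemma sq_pdList_le_sobDensity {k : ℕ} {l : List (Fin 3)} (hl : l.length ≤ k)
    (u : (Fin 3 → ℝ) → ℝ) (x : Fin 3 → ℝ) : pdList l u x ^ 2 ≤ sobDensity k u x := by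
  have h1 : pdList (List.ofFn l.get) u x ^ 2 ≤
      ∑ idx : Fin l.length → Fin 3, pdList (List.ofFn idx) u x ^ 2 :=
    Finset.single_le_sum (f := fun idx : Fin l.length → Fin 3 => pdList (List.ofFn idx) u x ^ 2)
      (fun _ _ => sq_nonneg _) (Finset.mem_univ l.get)
  rw [List.ofFn_get] at h1
  exact h1.trans <| Finset.single_le_sum
    (f := fun j => ∑ idx : Fin j → Fin 3, pdList (List.ofFn idx) u x ^ 2)
    (fun _ _ => Finset.sum_nonneg fun _ _ => sq_nonneg _) (by simp; omega)

lemma sobDensity_nonneg (k : ℕ) (u : (Fin 3 → ℝ) → ℝ) (x : Fin 3 → ℝ) : 0 ≤ sobDensity k u x :=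
  Finset.sum_nonneg fun _ _ => Finset.sum_nonneg fun _ _ => sq_nonneg _

lemma continuous_pdList {k : ℕ} {u : (Fin 3 → ℝ) → ℝ} (hu : ContDiff ℝ k u)
    {l : List (Fin 3)} (hl : l.length ≤ k) : Continuous (pdList l u) :=
  (contDiff_pdList (n := 0) (hu.of_le (by simpa using hl))).continuous

lemma continuous_sum_sq_pdList {j k : ℕ} (hj : j ≤ k) {u : (Fin 3 → ℝ) → ℝ}
    (hu : ContDiff ℝ k u) :
    Continuous fun x => ∑ idx : Fin j → Fin 3, pdList (List.ofFn idx) u x ^ 2 :=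
  continuous_finsetSum _ fun idx _ => (continuous_pdList hu (by simpa using hj)).pow 2

lemma continuous_sobDensity {k : ℕ} {u : (Fin 3 → ℝ) → ℝ} (hu : ContDiff ℝ k u) :
    Continuous (sobDensity k u) :=
  continuous_finsetSum _ fun _ hj =>
    continuous_sum_sq_pdList (Nat.lt_succ_iff.1 (Finset.mem_range.1 hj)) hu

lemma sobInnerOn_self {A : ℝ} {k : ℕ} {u : (Fin 3 → ℝ) → ℝ} (hu : ContDiff ℝ k u) :
    sobInnerOn k (Omega3 A) u u = ∫ x in Omega3 A, sobDensity k u x := by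
  simp only [sobInnerOn, sobDensity, ← sq]
  rw [integral_finsetSum]
  intro j hj
  exact (continuous_sum_sq_pdList
    (Nat.lt_succ_iff.1 (Finset.mem_range.1 hj)) hu).integrableOn_Omega3 A

lemma sobInnerOn_self_nonneg {A : ℝ} {k : ℕ} (u : (Fin 3 → ℝ) → ℝ) :
    0 ≤ sobInnerOn k (Omega3 A) u u :=
  Finset.sum_nonneg fun _ _ => integral_nonneg fun _ =>
    Finset.sum_nonneg fun _ _ => mul_self_nonneg _

lemma ofReal_sobInnerOn_self {A : ℝ} {k : ℕ} {u : (Fin 3 → ℝ) → ℝ} (hu : ContDiff ℝ k u) :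
    ENNReal.ofReal (sobInnerOn k (Omega3 A) u u) =
      ∫⁻ x in Omega3 A, ENNReal.ofReal (sobDensity k u x) := by
  rw [sobInnerOn_self hu]
  exact ofReal_integral_eq_lintegral_ofReal ((continuous_sobDensity hu).integrableOn_Omega3 A)
    (Filter.Eventually.of_forall (sobDensity_nonneg k u))

lemma measurableSet_Omega3 (A : ℝ) : MeasurableSet (Omega3 A) := by
  rw [Omega3_eq_pi_s13]
  exact MeasurableSet.univ_pi fun i => measurableSet_Ioo

/-- The product of first derivatives of two functions is controlled in `L²` by their `H³` norms.
The first factor is bounded uniformly in the first two variables and the second one uniformly in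
the third variable, which only takes one derivative in each of these variables. -/
lemma exists_integral_sq_pd_mul_sq_pd_le (A : ℝ) :
    ∃ K : ℝ, 0 ≤ K ∧ ∀ u v : (Fin 3 → ℝ) → ℝ, ContDiff ℝ 3 u → ContDiff ℝ 3 v → ∀ i j : Fin 3,
      ∫ x in Omega3 A, pd i u x ^ 2 * pd j v x ^ 2 ≤
        K * (sobInnerOn 3 (Omega3 A) u u * sobInnerOn 3 (Omega3 A) v v) := by
  set K₁ : ENNReal :=
    ENNReal.ofReal (sideConst A 0) * (2 * (ENNReal.ofReal (sideConst A 1) * 2)) with hK₁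
  set K₂ : ENNReal := ENNReal.ofReal (sideConst A 2) * 2 with hK₂
  have hK : K₁ * K₂ ≠ ⊤ := by finiteness
  refine ⟨(K₁ * K₂).toReal, ENNReal.toReal_nonneg, fun u v hu hv i j => ?_⟩
  have hpu : ContDiff ℝ 2 (pd i u) := contDiff_pd hu (by norm_num) i
  have hpv : ContDiff ℝ 2 (pd j v) := contDiff_pd hv (by norm_num) j
  have hDu : Measurable (sobDensity 3 u) := (continuous_sobDensity hu).measurable
  have hDv : Measurable (sobDensity 3 v) := (continuous_sobDensity hv).measurable
  have hcont : Continuous fun x => pd i u x ^ 2 * pd j v x ^ 2 :=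
    (hpu.continuous.pow 2).mul (hpv.continuous.pow 2)
  have hnn : 0 ≤ sobInnerOn 3 (Omega3 A) u u * sobInnerOn 3 (Omega3 A) v v :=
    mul_nonneg (sobInnerOn_self_nonneg u) (sobInnerOn_self_nonneg v)
  rw [← ENNReal.ofReal_le_ofReal_iff (mul_nonneg ENNReal.toReal_nonneg hnn),
    ENNReal.ofReal_mul ENNReal.toReal_nonneg, ENNReal.ofReal_toReal hK,
    ENNReal.ofReal_mul (sobInnerOn_self_nonneg u), ofReal_sobInnerOn_self hu,
    ofReal_sobInnerOn_self hv, ofReal_integral_eq_lintegral_ofReal (hcont.integrableOn_Omega3 A)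
      (Filter.Eventually.of_forall fun x => by simp only [Pi.zero_apply]; positivity)]
  have hcompl : ({2} : Finset (Fin 3)) = {0, 1}ᶜ := by decide
  rw [← pi_sideMeasure, ← lintegral_lmarginal_mul_lmarginal_compl (sideMeasure A)
    hDu.ennreal_ofReal hDv.ennreal_ofReal {0, 1}, ← hcompl, ← lintegral_const_mul' _ _ hK,
    pi_sideMeasure]
  refine setLIntegral_mono' (measurableSet_Omega3 A) fun x hx => ?_
  rw [Omega3_eq_pi_s13] at hx
  have hxi (i : Fin 3) : x i ∈ side A i := hx i (Set.mem_univ i)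
  rw [ENNReal.ofReal_mul (sq_nonneg _), mul_mul_mul_comm]
  gcongr
  · refine ofReal_sq_le_lmarginal_pair_of_le hpu hDu (by decide) ?_ ?_ ?_ ?_ (hxi 0) (hxi 1)
    · exact sq_pdList_le_sobDensity (l := [i]) (by simp) u
    · exact sq_pdList_le_sobDensity (l := [0, i]) (by simp) u
    · exact sq_pdList_le_sobDensity (l := [1, i]) (by simp) u
    · exact sq_pdList_le_sobDensity (l := [1, 0, i]) (by simp) u
  · refine ofReal_sq_le_lmarginal_of_le (hpv.of_le (by norm_num)) ?_ ?_ (hxi 2)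
    · exact sq_pdList_le_sobDensity (l := [j]) (by simp) v
    · exact sq_pdList_le_sobDensity (l := [2, j]) (by simp) v

/-- `|∇P|²`, summed over the components of `P`. -/
def gradSq {N : ℕ} (P : Fin N → (Fin 3 → ℝ) → ℝ) (x : Fin 3 → ℝ) : ℝ :=
  ∑ m, ∑ i, pd i (P m) x ^ 2

lemma gradSq_nonneg {N : ℕ} (P : Fin N → (Fin 3 → ℝ) → ℝ) (x : Fin 3 → ℝ) : 0 ≤ gradSq P x :=
  Finset.sum_nonneg fun _ _ => Finset.sum_nonneg fun _ _ => sq_nonneg _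

lemma sq_pd_le_gradSq {N : ℕ} (P : Fin N → (Fin 3 → ℝ) → ℝ) (m : Fin N) (i : Fin 3)
    (x : Fin 3 → ℝ) : pd i (P m) x ^ 2 ≤ gradSq P x :=
  (Finset.single_le_sum (f := fun i => pd i (P m) x ^ 2)
    (fun _ _ => sq_nonneg _) (Finset.mem_univ i)).trans <|
  Finset.single_le_sum (f := fun m => ∑ i, pd i (P m) x ^ 2)
    (fun _ _ => Finset.sum_nonneg fun _ _ => sq_nonneg _) (Finset.mem_univ m)

lemma abs_pd_mul_pd_le {N : ℕ} (P h : Fin N → (Fin 3 → ℝ) → ℝ) (m n : Fin N) (i : Fin 3)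
    (x : Fin 3 → ℝ) : |pd i (P m) x * pd i (h n) x| ≤ √(gradSq P x * gradSq h x) := by
  apply Real.abs_le_sqrt
  rw [mul_pow]
  exact mul_le_mul (sq_pd_le_gradSq P m i x) (sq_pd_le_gradSq h n i x) (sq_nonneg _)
    (gradSq_nonneg P x)

lemma sq_FmapDir_le {N : ℕ} (Fc : Fin N → Fin N → Fin N → ℝ) (P h : Fin N → (Fin 3 → ℝ) → ℝ)
    (k : Fin N) (x : Fin 3 → ℝ) :
    FmapDir Fc P h k x ^ 2 ≤ (6 * ∑ m, ∑ n, |Fc k m n|) ^ 2 * (gradSq P x * gradSq h x) := by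
  set r := √(gradSq P x * gradSq h x) with hr
  have hnn : 0 ≤ gradSq P x * gradSq h x := mul_nonneg (gradSq_nonneg P x) (gradSq_nonneg h x)
  have habs : |FmapDir Fc P h k x| ≤ (6 * ∑ m, ∑ n, |Fc k m n|) * r := by
    calc |FmapDir Fc P h k x| ≤ ∑ m, ∑ n, |Fc k m n| * ∑ i : Fin 3, (r + r) := by
          refine (Finset.abs_sum_le_sum_abs _ _).trans (Finset.sum_le_sum fun m _ => ?_)
          refine (Finset.abs_sum_le_sum_abs _ _).trans (Finset.sum_le_sum fun n _ => ?_)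
          rw [abs_mul]
          gcongr
          refine (Finset.abs_sum_le_sum_abs _ _).trans (Finset.sum_le_sum fun i _ => ?_)
          refine (abs_add_le _ _).trans (add_le_add ?_ (abs_pd_mul_pd_le P h m n i x))
          rw [mul_comm]
          exact abs_pd_mul_pd_le P h n m i x
      _ = (6 * ∑ m, ∑ n, |Fc k m n|) * r := by
          simp only [← Finset.sum_mul, Finset.sum_const, Finset.card_univ, Fintype.card_fin]
          ring
  calc FmapDir Fc P h k x ^ 2 = |FmapDir Fc P h k x| ^ 2 := (sq_abs _).symm
    _ ≤ ((6 * ∑ m, ∑ n, |Fc k m n|) * r) ^ 2 := by gcongr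
    _ = _ := by rw [mul_pow, hr, Real.sq_sqrt hnn]

lemma FmapDir_sub {N : ℕ} (Fc : Fin N → Fin N → Fin N → ℝ)
    {Q₁ Q₂ : Fin N → (Fin 3 → ℝ) → ℝ} (h : Fin N → (Fin 3 → ℝ) → ℝ)
    (hQ₁ : ∀ k, Differentiable ℝ (Q₁ k)) (hQ₂ : ∀ k, Differentiable ℝ (Q₂ k))
    (k : Fin N) (x : Fin 3 → ℝ) :
    FmapDir Fc (Q₁ - Q₂) h k x = FmapDir Fc Q₁ h k x - FmapDir Fc Q₂ h k x := by
  have hpd (i : Fin 3) (m : Fin N) : pd i ((Q₁ - Q₂) m) x = pd i (Q₁ m) x - pd i (Q₂ m) x := by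
    simp [pd, fderiv_sub (hQ₁ m x) (hQ₂ m x)]
  simp only [FmapDir, hpd, ← Finset.sum_sub_distrib, ← mul_sub]
  refine Finset.sum_congr rfl fun m _ => Finset.sum_congr rfl fun n _ => ?_
  congr 1
  exact Finset.sum_congr rfl fun i _ => by ring

lemma continuous_gradSq {N : ℕ} {P : Fin N → (Fin 3 → ℝ) → ℝ} (hP : ∀ k, ContDiff ℝ 3 (P k)) :
    Continuous (gradSq P) :=
  continuous_finsetSum _ fun m _ => continuous_finsetSum _ fun i _ =>
    (contDiff_pd (hP m) (m := 2) (by norm_num) i).continuous.pow 2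

lemma exists_integral_gradSq_mul_gradSq_le (A : ℝ) (N : ℕ) :
    ∃ K : ℝ, 0 ≤ K ∧ ∀ P h : Fin N → (Fin 3 → ℝ) → ℝ,
      (∀ k, ContDiff ℝ 3 (P k)) → (∀ k, ContDiff ℝ 3 (h k)) →
      ∫ x in Omega3 A, gradSq P x * gradSq h x ≤
        K * (vSobInnerOn N 3 (Omega3 A) P P * vSobInnerOn N 3 (Omega3 A) h h) := by
  obtain ⟨K, hK, hle⟩ := exists_integral_sq_pd_mul_sq_pd_le A
  refine ⟨9 * K, by positivity, fun P h hP hh => ?_⟩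
  have hint (m n : Fin N) (i j : Fin 3) :
      IntegrableOn (fun x => pd i (P m) x ^ 2 * pd j (h n) x ^ 2) (Omega3 A) := by
    refine Continuous.integrableOn_Omega3 ?_ A
    exact ((contDiff_pd (hP m) (m := 2) (by norm_num) i).continuous.pow 2).mul
      ((contDiff_pd (hh n) (m := 2) (by norm_num) j).continuous.pow 2)
  have hsum : ∫ x in Omega3 A, gradSq P x * gradSq h x =
      ∑ p : (Fin N × Fin 3) × Fin N × Fin 3,
        ∫ x in Omega3 A, pd p.1.2 (P p.1.1) x ^ 2 * pd p.2.2 (h p.2.1) x ^ 2 := by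
    rw [← integral_finsetSum]
    swap
    · exact fun p _ => hint p.1.1 p.2.1 p.1.2 p.2.2
    congr with x
    simp only [gradSq, ← Fintype.sum_prod_type', Fintype.sum_mul_sum]
  rw [hsum]
  refine (Finset.sum_le_sum fun p _ => hle _ _ (hP p.1.1) (hh p.2.1) p.1.2 p.2.2).trans_eq ?_
  simp only [vSobInnerOn, Fintype.sum_prod_type, Finset.sum_const, Finset.card_univ,
    Fintype.card_fin, nsmul_eq_mul]
  rw [Finset.sum_mul_sum]
  simp only [Finset.mul_sum]
  refine Finset.sum_congr rfl fun m _ => Finset.sum_congr rfl fun n _ => ?_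
  push_cast
  ring

lemma cwf_nonneg (lam nu xi a x3 : ℝ) : 0 ≤ cwf lam nu xi a x3 := by
  unfold cwf
  positivity

lemma cwf_le {lam nu xi a x3 : ℝ} (hlam : 0 ≤ lam) (hnu : 0 ≤ nu) (hxi : 0 < xi) (ha : 0 ≤ a)
    (hx3 : 0 ≤ x3) : cwf lam nu xi a x3 ≤ Real.exp (lam * xi ^ (-nu)) := by
  have h1 : (x3 + xi) ^ (-nu) ≤ xi ^ (-nu) :=
    Real.rpow_le_rpow_of_nonpos hxi (by linarith) (by linarith)
  have h2 : Real.exp (-lam * (a + xi) ^ (-nu)) ≤ 1 := by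
    rw [Real.exp_le_one_iff, neg_mul, neg_nonpos]
    positivity
  calc cwf lam nu xi a x3 ≤ Real.exp (lam * xi ^ (-nu)) * 1 := by
        unfold cwf
        gcongr
    _ = _ := mul_one _

/-- **Lipschitz continuity of `Q ↦ Z′(Q)`.**
With `Z(Q) = ΔQ + F(∇Q)` and `Z′(Q)h = Δh + F′(∇Q)∇h`, there is `C₁ = C₁(Ω,G,F) > 0`
such that for all `Q₁, Q₂ ∈ G(R,Φ,Ψ)` and all `h ∈ H₀³(Ω)`:
`‖Z′(Q₁)h − Z′(Q₂)h‖_{L₂^{λ,ν₀}(Ω)} ≤ C₁ e^{λξ^{-ν₀}} ‖Q₁−Q₂‖_{H³(Ω)} ‖h‖_{H³(Ω)}`. -/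
theorem Zprime_lipschitz (A a xi R nu0 : ℝ) (N : ℕ)
    (Fc : Fin N → Fin N → Fin N → ℝ) (Φ Ψ : Fin N → (Fin 3 → ℝ) → ℝ)
    (hA : 0 < A) (ha : a ∈ Ioo (0:ℝ) (1/2)) (hxi : xi ∈ Ioo (0:ℝ) (1/2))
    (hR : 0 < R) (hN : 1 ≤ N) (hnu0 : 1 < nu0) :
    ∃ C1 > (0:ℝ), ∀ lam > (1:ℝ),
      ∀ Q1 ∈ GSet N A R Φ Ψ, ∀ Q2 ∈ GSet N A R Φ Ψ, ∀ h ∈ H03 N A,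
        Real.sqrt (∫ x in Omega3 A,
            (∑ k, ((lap (h k) x + FmapDir Fc Q1 h k x)
                    - (lap (h k) x + FmapDir Fc Q2 h k x))^2)
              * (cwf lam nu0 xi a (x 2))^2)
          ≤ C1 * Real.exp (lam * xi ^ (-nu0))
              * vSobNormOn N 3 (Omega3 A) (Q1 - Q2) * vSobNormOn N 3 (Omega3 A) h := by
  obtain ⟨K, hK, hle⟩ := exists_integral_gradSq_mul_gradSq_le A N
  set B : ℝ := ∑ k, (6 * ∑ m, ∑ n, |Fc k m n|) ^ 2 with hB
  have hB0 : 0 ≤ B := Finset.sum_nonneg fun _ _ => sq_nonneg _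
  refine ⟨√(B * K) + 1, by positivity, fun lam hlam Q1 hQ1 Q2 hQ2 h hh => ?_⟩
  set P := Q1 - Q2 with hP
  set E := Real.exp (lam * xi ^ (-nu0)) with hE
  have hPc : ∀ k, ContDiff ℝ 3 (P k) := fun k => (hQ1.1 k).sub (hQ2.1 k)
  have hpt : ∀ x ∈ Omega3 A,
      (∑ k, ((lap (h k) x + FmapDir Fc Q1 h k x) - (lap (h k) x + FmapDir Fc Q2 h k x)) ^ 2)
          * (cwf lam nu0 xi a (x 2)) ^ 2 ≤ B * E ^ 2 * (gradSq P x * gradSq h x) := by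
    intro x hx
    have hcwf : cwf lam nu0 xi a (x 2) ≤ E :=
      cwf_le (by linarith) (by linarith) hxi.1 ha.1.le hx.2.2.1.le
    have hcwf0 := cwf_nonneg lam nu0 xi a (x 2)
    have hsum : ∑ k, ((lap (h k) x + FmapDir Fc Q1 h k x)
        - (lap (h k) x + FmapDir Fc Q2 h k x)) ^ 2 ≤ B * (gradSq P x * gradSq h x) := by
      rw [hB, Finset.sum_mul]
      refine Finset.sum_le_sum fun k _ => ?_
      rw [add_sub_add_left_eq_sub, ← FmapDir_sub Fc h
        (fun k => (hQ1.1 k).differentiable (by norm_num))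
        (fun k => (hQ2.1 k).differentiable (by norm_num))]
      exact sq_FmapDir_le Fc P h k x
    calc _ ≤ B * (gradSq P x * gradSq h x) * E ^ 2 := by
          have := gradSq_nonneg P x
          have := gradSq_nonneg h x
          gcongr
      _ = _ := by ring
  have hint : ∫ x in Omega3 A,
      (∑ k, ((lap (h k) x + FmapDir Fc Q1 h k x) - (lap (h k) x + FmapDir Fc Q2 h k x)) ^ 2)
          * (cwf lam nu0 xi a (x 2)) ^ 2 ≤
      B * K * E ^ 2 * (vSobInnerOn N 3 (Omega3 A) P P * vSobInnerOn N 3 (Omega3 A) h h) := by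
    calc _ ≤ ∫ x in Omega3 A, B * E ^ 2 * (gradSq P x * gradSq h x) := by
          refine integral_mono_of_nonneg (Filter.Eventually.of_forall fun x => ?_) ?_ ?_
          · exact mul_nonneg (Finset.sum_nonneg fun _ _ => sq_nonneg _) (sq_nonneg _)
          · exact (((continuous_gradSq hPc).mul
              (continuous_gradSq hh.1)).integrableOn_Omega3 A).const_mul _
          · exact (ae_restrict_iff' (measurableSet_Omega3 A)).2 (Filter.Eventually.of_forall hpt)
      _ = B * E ^ 2 * ∫ x in Omega3 A, gradSq P x * gradSq h x := integral_const_mul _ _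
      _ ≤ B * E ^ 2 *
          (K * (vSobInnerOn N 3 (Omega3 A) P P * vSobInnerOn N 3 (Omega3 A) h h)) := by
          gcongr
          exact hle P h hPc hh.1
      _ = _ := by ring
  refine (Real.sqrt_le_sqrt hint).trans ?_
  have hPP : 0 ≤ vSobInnerOn N 3 (Omega3 A) P P :=
    Finset.sum_nonneg fun _ _ => sobInnerOn_self_nonneg _
  rw [Real.sqrt_mul (by positivity), Real.sqrt_mul hPP, Real.sqrt_mul (by positivity),
    Real.sqrt_sq (by positivity), ← mul_assoc]
  unfold vSobNormOn
  gcongr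
  linarith

end
end
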